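/- arXiv:2509.16468 — 4 statements merged into one kernel-verified Lean document; each statement's English description precedes it below -/
import Mathlib

section
/- Let r ≥ 1 and let S ⊆ S_r × S_r be a set of pairs of permutations such that: (a) (u,v) ∈ S for every pair (u,v) for which u < v fails in the Bruhat order (where u < v means u ≤ v and u ≠ v); and (b) for all u, v ∈ S_r and every simple reflection s = (i, i+1) (1 ≤ i ≤ r−1), if (u·s, v·s) ∈ S and (u, v·s) ∈ S then (u,v) ∈ S. Then S = S_r × S_r. -/
/-- `ℓ(w)`: the number of inversions of a permutation of `{1,…,r}` (0-indexed as `Fin r`). -/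
def invCount {r : ℕ} (w : Equiv.Perm (Fin r)) : ℕ :=
  (Finset.univ.filter fun p : Fin r × Fin r => p.1 < p.2 ∧ w p.2 < w p.1).card

/-- A transposition in `S_r`. -/
def IsTransposition {r : ℕ} (t : Equiv.Perm (Fin r)) : Prop :=
  ∃ a b : Fin r, a ≠ b ∧ t = Equiv.swap a b

/-- Bruhat order: `u ≤ v` iff there are transpositions `t_1,…,t_k` with
`v = u·t_1⋯t_k` and the length (inversion count) strictly increasing at each step. -/
def bruhatLE {r : ℕ} (u v : Equiv.Perm (Fin r)) : Prop :=
  Relation.ReflTransGen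
    (fun x y => ∃ t, IsTransposition t ∧ y = x * t ∧ invCount x < invCount y) u v

/-- if `S ⊆ S_r × S_r` contains all pairs `(u,v)` with `¬(u < v)` in Bruhat order,
and is closed under the rule `(u·s, v·s) ∈ S → (u, v·s) ∈ S → (u,v) ∈ S` for every simple
reflection `s = (i, i+1)`, then `S = S_r × S_r`. -/
theorem stmt3 (r : ℕ) (hr : 1 ≤ r)
    (S : Set (Equiv.Perm (Fin r) × Equiv.Perm (Fin r)))
    (ha : ∀ u v : Equiv.Perm (Fin r), ¬(bruhatLE u v ∧ u ≠ v) → (u, v) ∈ S)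
    (hb : ∀ (u v : Equiv.Perm (Fin r)) (i : ℕ) (h1 : 1 ≤ i) (h2 : i ≤ r - 1),
      (u * Equiv.swap (⟨i - 1, by omega⟩ : Fin r) (⟨i, by omega⟩ : Fin r),
        v * Equiv.swap (⟨i - 1, by omega⟩ : Fin r) (⟨i, by omega⟩ : Fin r)) ∈ S →
      (u, v * Equiv.swap (⟨i - 1, by omega⟩ : Fin r) (⟨i, by omega⟩ : Fin r)) ∈ S →
      (u, v) ∈ S) :
    S = Set.univ := by
  obtain ⟨n, rfl⟩ : ∃ n, r = n + 1 := ⟨r - 1, by omega⟩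
  have hle : ∀ u v : Equiv.Perm (Fin (n+1)), bruhatLE u v → u = v ∨ invCount u < invCount v := by
    intro u v h
    induction h with
    | refl => exact Or.inl rfl
    | tail _ h ih =>
      obtain ⟨t, _, _, h⟩ := h
      rcases ih with rfl | ih
      · exact Or.inr h
      · exact Or.inr (ih.trans h)
  have key : ∀ (f : Lex (Fin (n+1) → Fin (n+1))) (v : Equiv.Perm (Fin (n+1))),
      toLex (v : Fin (n+1) → Fin (n+1)) = f → ∀ u, (u, v) ∈ S := by
    intro f
    induction f using WellFoundedLT.induction with
    | ind f ih =>
      rintro v rfl u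
      by_cases hm : Monotone v
      · apply ha
        rintro ⟨h, hne⟩
        rcases hle u v h with h | h
        · exact hne h
        · have h0 : invCount v = 0 := by
            unfold invCount
            rw [Finset.card_eq_zero, Finset.filter_eq_empty_iff]
            rintro p - ⟨h1, h2⟩
            exact absurd (hm h1.le) (not_le.2 h2)
          omega
      · rw [Fin.monotone_iff_le_succ] at hm
        push Not at hm
        obtain ⟨i, hi⟩ := hm
        have hlt := Pi.lex_desc (f := (v : Fin (n+1) → Fin (n+1)))
          (Fin.castSucc_lt_succ (i := i)).le hi
        have hall := ih _ hlt (v * Equiv.swap i.castSucc i.succ) rfl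
        exact hb u v (i.1 + 1) (by omega) (by omega) (hall _) (hall _)
  exact Set.eq_univ_of_forall fun ⟨u, v⟩ => key _ v rfl u
end

section
/- If w_c = w_d, then the system S(λ; w_1,w_2,w_3,w_4) has exactly one state. -/
/-- A spin: `Sum.inl a` is the color `c_{a+1}`, `Sum.inr b` is the dolor `d_{b+1}`
(so indices are 0-based). -/
abbrev Spin (r : ℕ) := Fin r ⊕ Fin r

/-- The `k`-th boson (0-indexed) in the monochrome ordering:
`(c_a, d_b) < (c_{a'}, d_{b'})` iff `b > b'`, or `b = b'` and `a < a'`.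
A boson is recorded as the pair (color index, dolor index), 0-based. -/
def bosonOfIdx {r : ℕ} (k : Fin (r * r)) : Fin r × Fin r :=
  have hr : 0 < r := by
    rcases Nat.eq_zero_or_pos r with h | h
    · exact absurd k.2 (by simp [h])
    · exact h
  (⟨k.val % r, Nat.mod_lt _ hr⟩,
   ⟨r - 1 - k.val / r, lt_of_le_of_lt (Nat.sub_le _ _) (Nat.sub_lt hr one_pos)⟩)

/-- One admissibility step at boson `ab = (a,b)`, from spin `x` to spin `y`,
where `m` is the multiplicity function on the top edge and `m'` on the bottom edge:
either a pass, a split, or a merge. -/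
def StepOK {r : ℕ} (m m' : Fin r × Fin r → ℕ) (ab : Fin r × Fin r)
    (x y : Spin r) : Prop :=
  (y = x ∧ m' ab = m ab) ∨
  (x = Sum.inr ab.2 ∧ y = Sum.inl ab.1 ∧ m ab = m' ab + 1) ∨
  (x = Sum.inl ab.1 ∧ y = Sum.inr ab.2 ∧ m' ab = m ab + 1)

/-- Admissibility of a vertex datum: left spin `l`, top multiplicities `m`,
right spin `rr`, bottom multiplicities `m'`. -/
def AdmissibleVertex {r : ℕ} (l : Spin r) (m : Fin r × Fin r → ℕ) (rr : Spin r)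
    (m' : Fin r × Fin r → ℕ) : Prop :=
  ∃ x : Fin (r * r + 1) → Spin r, x 0 = l ∧ x (Fin.last _) = rr ∧
    ∀ k : Fin (r * r), StepOK m m' (bosonOfIdx k) (x k.castSucc) (x k.succ)

/-- The coefficient ring `ℤ[t][z_1,…,z_r]`, with `t = X none` and `z_{i+1} = X (some i)`. -/
abbrev PolyR (r : ℕ) := MvPolynomial (Option (Fin r)) ℤ

/-- The variable `t`. -/
noncomputable def tP (r : ℕ) : PolyR r := MvPolynomial.X none

/-- The variable `z_{i+1}`. -/
noncomputable def zP {r : ℕ} (i : Fin r) : PolyR r := MvPolynomial.X (some i)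

/-- Weight of a pass step at boson `ab`, where the horizontal spin is `x`,
`n` is the number of bosons on the (equal) vertical edges, and `zi` is the row parameter. -/
noncomputable def passWeight {r : ℕ} (zi : PolyR r) (n : ℕ) (ab : Fin r × Fin r)
    (x : Spin r) : PolyR r :=
  match x with
  | Sum.inl e => if e = ab.1 then zi else if e < ab.1 then tP r ^ n else 1
  | Sum.inr e =>
      if e = ab.2 then 1
      else if ab.1.val = 0 then (if e < ab.2 then tP r ^ n * zi else zi)
      else (if e < ab.2 then tP r ^ n else 1)

/-- Weight of the step at boson `ab` with top multiplicity `m`, bottom multiplicity `m'`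
and incoming horizontal spin `x`. -/
noncomputable def stepWeight {r : ℕ} (zi : PolyR r) (m m' : ℕ) (ab : Fin r × Fin r)
    (x : Spin r) : PolyR r :=
  if m = m' + 1 then ∑ j ∈ Finset.range (min m m' + 1), tP r ^ j
  else if m' = m + 1 then (1 - tP r) * zi
  else passWeight zi (min m m') ab x

/-- The (necessarily unique) next horizontal spin at a boson `ab`. -/
def nextSpin {r : ℕ} (m m' : Fin r × Fin r → ℕ) (ab : Fin r × Fin r) (x : Spin r) : Spin r :=
  if m ab = m' ab + 1 then Sum.inl ab.1
  else if m' ab = m ab + 1 then Sum.inr ab.2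
  else x

/-- The sequence of horizontal spins inside a vertex, starting from the left spin `l`.
For an admissible vertex this coincides with the unique admissibility sequence. -/
def pathSpin {r : ℕ} (m m' : Fin r × Fin r → ℕ) (l : Spin r) : ℕ → Spin r
  | 0 => l
  | k + 1 =>
      if h : k < r * r then nextSpin m m' (bosonOfIdx ⟨k, h⟩) (pathSpin m m' l k)
      else pathSpin m m' l k

/-- Boltzmann weight of an admissible vertex with row parameter `zi`, left spin `l`,
top multiplicities `m` and bottom multiplicities `m'`. -/
noncomputable def vertexWeight {r : ℕ} (zi : PolyR r) (l : Spin r)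
    (m m' : Fin r × Fin r → ℕ) : PolyR r :=
  ∏ k : Fin (r * r),
    stepWeight zi (m (bosonOfIdx k)) (m' (bosonOfIdx k)) (bosonOfIdx k)
      (pathSpin m m' l k.val)

open Classical in
/-- `W(l, m, rr, m')`: the weight of the vertex datum if admissible, and `0` otherwise. -/
noncomputable def Wvert {r : ℕ} (zi : PolyR r) (l : Spin r) (m : Fin r × Fin r → ℕ)
    (rr : Spin r) (m' : Fin r × Fin r → ℕ) : PolyR r :=
  if AdmissibleVertex l m rr m' then vertexWeight zi l m m' else 0

/-- A filling of the `r × N` grid: `m i j` are the boson multiplicities on the vertical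
edge of column `j` between rows `i` and `i+1` (row `0` is the top boundary),
and `h i j` is the horizontal spin of row `i+1` immediately to the right of column `j`
(`j = N` is the left boundary, `j = 0` the right boundary). -/
structure Filling (r N : ℕ) where
  m : Fin (r + 1) → Fin N → Fin r × Fin r → ℕ
  h : Fin r → Fin (N + 1) → Spin r

/-- A state: every vertex is admissible. -/
def Filling.IsState {r N : ℕ} (f : Filling r N) : Prop :=
  ∀ (i : Fin r) (j : Fin N),
    AdmissibleVertex (f.h i j.succ) (f.m i.castSucc j) (f.h i j.castSucc) (f.m i.succ j)

/-- Membership in the system `S(λ; w_1, w_2, w_3, w_4)`. -/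
def InSystem {r N : ℕ} (lam : Fin r → ℕ) (w1 w2 w3 w4 : Equiv.Perm (Fin r))
    (f : Filling r N) : Prop :=
  f.IsState ∧
  (∀ (j : Fin N) (a b : Fin r),
      f.m 0 j (a, b) =
        (Finset.univ.filter fun i : Fin r =>
            lam i = j.val ∧ w3⁻¹ i = a ∧ w4⁻¹ (Fin.rev i) = b).card) ∧
  (∀ (j : Fin N) (ab : Fin r × Fin r), f.m (Fin.last r) j ab = 0) ∧
  (∀ i : Fin r, f.h i 0 = Sum.inl (w1⁻¹ i)) ∧
  (∀ i : Fin r, f.h i (Fin.last N) = Sum.inr (w2⁻¹ i))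

/-- The Boltzmann weight of a state: the product of the weights of its vertices. -/
noncomputable def stateWeight {r N : ℕ} (f : Filling r N) : PolyR r :=
  ∏ i : Fin r, ∏ j : Fin N,
    vertexWeight (zP i) (f.h i j.succ) (f.m i.castSucc j) (f.m i.succ j)

open Classical in
/-- The partition function `Z(λ; w_1, w_2, w_3, w_4)`: the sum of the weights of the
states of the system (a finite sum, expressed via `finsum`). -/
noncomputable def partitionZ (r N : ℕ) (lam : Fin r → ℕ)
    (w1 w2 w3 w4 : Equiv.Perm (Fin r)) : PolyR r :=
  finsum fun f : Filling r N =>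
    if InSystem lam w1 w2 w3 w4 f then stateWeight f else 0

/-- The state `f` has a merge at vertex `(i+1, j)`. -/
def HasMergeAt {r N : ℕ} (f : Filling r N) (i : Fin r) (j : Fin N) : Prop :=
  ∃ ab : Fin r × Fin r, f.m i.castSucc j ab < f.m i.succ j ab

theorem perm_app_inv {r : ℕ} (w : Equiv.Perm (Fin r)) (x : Fin r) : w (w⁻¹ x) = x :=
  w.apply_symm_apply x

theorem perm_inv_app {r : ℕ} (w : Equiv.Perm (Fin r)) (x : Fin r) : w⁻¹ (w x) = x :=
  w.symm_apply_apply x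

theorem bosonOfIdx_inj {r : ℕ} : Function.Injective (bosonOfIdx (r := r)) := by
  intro k l h
  simp only [bosonOfIdx, Prod.mk.injEq, Fin.mk.injEq] at h
  obtain ⟨h1, h2⟩ := h
  have hk : k.val / r < r := Nat.div_lt_of_lt_mul k.2
  have hl : l.val / r < r := Nat.div_lt_of_lt_mul l.2
  have h3 : k.val / r = l.val / r := by omega
  apply Fin.ext
  rw [← Nat.div_add_mod k.val r, ← Nat.div_add_mod l.val r, h1, h3]

theorem bosonOfIdx_surj {r : ℕ} : Function.Surjective (bosonOfIdx (r := r)) :=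
  ((Fintype.bijective_iff_injective_and_card _).2 ⟨bosonOfIdx_inj, by simp⟩).2

/-- Forward propagation of a dolor which meets no boson of the same dolor. -/
theorem forward_aux {r : ℕ} {m m' : Fin r × Fin r → ℕ} {b : Fin r} {x : Fin (r * r + 1) → Spin r}
    (hx : ∀ k : Fin (r * r), StepOK m m' (bosonOfIdx k) (x k.castSucc) (x k.succ))
    (h0 : x 0 = Sum.inr b) (n : ℕ)
    (hm : ∀ k : Fin (r * r), k.val < n → (bosonOfIdx k).2 = b → m (bosonOfIdx k) = 0) :
    ∀ k : Fin (r * r + 1), k.val ≤ n → x k = Sum.inr b := by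
  intro k
  induction k using Fin.induction with
  | zero => intro _; exact h0
  | succ k ih =>
    intro hk
    have hk' : k.val < n := by simpa using hk
    have h1 := ih (by simpa using hk'.le)
    rcases hx k with ⟨h, -⟩ | ⟨h, -, h2⟩ | ⟨h, -⟩
    · rw [h, h1]
    · rw [h1] at h
      have := hm k hk' (Sum.inr.inj h).symm
      omega
    · rw [h1] at h; cases h

/-- Backward propagation of a color which meets no boson of the same color. -/
theorem backward_aux {r : ℕ} {m m' : Fin r × Fin r → ℕ} {a : Fin r} {x : Fin (r * r + 1) → Spin r}
    (hx : ∀ k : Fin (r * r), StepOK m m' (bosonOfIdx k) (x k.castSucc) (x k.succ))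
    (h0 : x (Fin.last _) = Sum.inl a) (n : ℕ)
    (hm : ∀ k : Fin (r * r), n ≤ k.val → (bosonOfIdx k).1 = a → m (bosonOfIdx k) = 0) :
    ∀ k : Fin (r * r + 1), n ≤ k.val → x k = Sum.inl a := by
  intro k
  induction k using Fin.reverseInduction with
  | last => intro _; exact h0
  | cast k ih =>
    intro hk
    have hk' : n ≤ k.val := by simpa using hk
    have h1 := ih (by simp; omega)
    rcases hx k with ⟨h, -⟩ | ⟨-, h, h2⟩ | ⟨-, h, -⟩
    · rw [← h, h1]
    · rw [h1] at h
      have := hm k hk' (Sum.inl.inj h).symm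
      omega
    · rw [h1] at h; cases h

theorem step_pass {r : ℕ} {m m' : Fin r × Fin r → ℕ} {ab : Fin r × Fin r} {x : Spin r}
    (h : StepOK m m' ab x x) : m' ab = m ab := by
  rcases h with ⟨-, h⟩ | ⟨h, h', -⟩ | ⟨h, h', -⟩
  · exact h
  · rw [h] at h'; cases h'
  · rw [h] at h'; cases h'

theorem step_split {r : ℕ} {m m' : Fin r × Fin r → ℕ} {ab : Fin r × Fin r} {a b : Fin r}
    (h : StepOK m m' ab (Sum.inr b) (Sum.inl a)) : ab = (a, b) ∧ m ab = m' ab + 1 := by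
  rcases h with ⟨h, -⟩ | ⟨h, h', h2⟩ | ⟨h, h', -⟩
  · cases h
  · exact ⟨Prod.ext (Sum.inl.inj h').symm (Sum.inr.inj h).symm, h2⟩
  · cases h

theorem vertex_forward {r : ℕ} {m m' : Fin r × Fin r → ℕ} {b : Fin r} {y : Spin r}
    (h : AdmissibleVertex (Sum.inr b) m y m') (hm : ∀ a, m (a, b) = 0) :
    y = Sum.inr b ∧ m' = m := by
  obtain ⟨x, h0, h1, hx⟩ := h
  have H := forward_aux hx h0 (r * r) (by
    intro k _ hk; have := hm (bosonOfIdx k).1; rwa [← hk] at this)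
  refine ⟨by rw [← h1]; exact H _ (by simp), ?_⟩
  funext ab
  obtain ⟨k, rfl⟩ := bosonOfIdx_surj ab
  have := hx k
  rw [H _ (by simp), H _ (by simp)] at this
  exact step_pass this

theorem vertex_backward {r : ℕ} {m m' : Fin r × Fin r → ℕ} {a : Fin r} {y : Spin r}
    (h : AdmissibleVertex y m (Sum.inl a) m') (hm : ∀ b, m (a, b) = 0) :
    y = Sum.inl a ∧ m' = m := by
  obtain ⟨x, h0, h1, hx⟩ := h
  have H := backward_aux hx h1 0 (by
    intro k _ hk; have := hm (bosonOfIdx k).2; rwa [← hk] at this)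
  refine ⟨by rw [← h0]; exact H _ (by simp), ?_⟩
  funext ab
  obtain ⟨k, rfl⟩ := bosonOfIdx_surj ab
  have := hx k
  rw [H _ (by simp), H _ (by simp)] at this
  exact step_pass this

theorem vertex_split {r : ℕ} {m m' : Fin r × Fin r → ℕ} {a b : Fin r}
    (h : AdmissibleVertex (Sum.inr b) m (Sum.inl a) m') (hma : ∀ b', b' ≠ b → m (a, b') = 0)
    (hmb : ∀ a', a' ≠ a → m (a', b) = 0) :
    m (a, b) = m' (a, b) + 1 ∧ ∀ ab, ab ≠ (a, b) → m' ab = m ab := by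
  obtain ⟨x, h0, h1, hx⟩ := h
  obtain ⟨k0, hk0⟩ := bosonOfIdx_surj (a, b)
  have F := forward_aux hx h0 k0.val (by
    intro k hk hb
    have := hmb (bosonOfIdx k).1 (by
      intro ha
      have : bosonOfIdx k = bosonOfIdx k0 := by rw [hk0]; exact Prod.ext ha hb
      have := bosonOfIdx_inj this
      subst this; omega)
    rwa [← hb] at this)
  have B := backward_aux hx h1 (k0.val + 1) (by
    intro k hk ha
    have := hma (bosonOfIdx k).2 (by
      intro hb
      have : bosonOfIdx k = bosonOfIdx k0 := by rw [hk0]; exact Prod.ext ha hb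
      have := bosonOfIdx_inj this
      subst this; omega)
    rwa [← ha] at this)
  constructor
  · have := hx k0
    rw [F _ (by simp), B _ (by simp)] at this
    have := (step_split this).2
    rwa [hk0] at this
  · intro ab hab
    obtain ⟨k, rfl⟩ := bosonOfIdx_surj ab
    have hne : k ≠ k0 := by rintro rfl; exact hab hk0
    have hne' : k.val ≠ k0.val := fun h => hne (Fin.ext h)
    have := hx k
    rcases lt_or_gt_of_ne hne' with hlt | hgt
    · rw [F _ (by simp; omega), F _ (by simp; omega)] at this
      exact step_pass this
    · rw [B _ (by simp; omega), B _ (by simp; omega)] at this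
      exact step_pass this

theorem vertex_pass_adm {r : ℕ} (m : Fin r × Fin r → ℕ) (y : Spin r) :
    AdmissibleVertex y m y m :=
  ⟨fun _ => y, rfl, rfl, fun _ => Or.inl ⟨rfl, rfl⟩⟩

theorem vertex_split_adm {r : ℕ} {m m' : Fin r × Fin r → ℕ} {a b : Fin r}
    (h1 : m (a, b) = m' (a, b) + 1) (h2 : ∀ ab, ab ≠ (a, b) → m' ab = m ab) :
    AdmissibleVertex (Sum.inr b) m (Sum.inl a) m' := by
  obtain ⟨k0, hk0⟩ := bosonOfIdx_surj (a, b)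
  refine ⟨fun k => if k.val ≤ k0.val then Sum.inr b else Sum.inl a, by simp, ?_, ?_⟩
  · have := k0.2
    simp
  · intro k
    rcases lt_trichotomy k.val k0.val with h | h | h
    · left
      refine ⟨?_, h2 _ ?_⟩
      · simp [h.le, Nat.succ_le_of_lt h]
      · rw [← hk0]; intro h'; have := bosonOfIdx_inj h'; subst this; omega
    · have : k = k0 := Fin.ext h
      subst this
      right; left
      simp [hk0, h1]
    · left
      refine ⟨?_, h2 _ ?_⟩
      · have h3 : ¬ k.val ≤ k0.val := by omega
        have h4 : ¬ k.val + 1 ≤ k0.val := by omega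
        simp [h3, h4]
      · rw [← hk0]; intro h'; have := bosonOfIdx_inj h'; subst this; omega

/-- Multiplicities of the unique state. -/
def theM {r : ℕ} (lam : Fin r → ℕ) (w1 w2 w3 : Equiv.Perm (Fin r)) (i j : ℕ)
    (ab : Fin r × Fin r) : ℕ :=
  if w1 ab.1 = w2 ab.2 ∧ i ≤ (w1 ab.1).val ∧ lam (w3 ab.1) = j then 1 else 0

/-- Horizontal spins of the unique state. -/
def theH {r : ℕ} (lam : Fin r → ℕ) (w1 w2 w3 : Equiv.Perm (Fin r)) (i : Fin r) (j : ℕ) :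
    Spin r :=
  if j ≤ lam (w3 (w1⁻¹ i)) then Sum.inl (w1⁻¹ i) else Sum.inr (w2⁻¹ i)

theorem theM_top {r : ℕ} (lam : Fin r → ℕ) (w1 w2 w3 w4 : Equiv.Perm (Fin r))
    (hcd : w3 * w1⁻¹ = Fin.revPerm * w4 * w2⁻¹) (j : ℕ) (a b : Fin r) :
    theM lam w1 w2 w3 0 j (a, b) = (Finset.univ.filter fun i : Fin r =>
            lam i = j ∧ w3⁻¹ i = a ∧ w4⁻¹ (Fin.rev i) = b).card := by
  have key : w4⁻¹ (Fin.rev (w3 a)) = b ↔ w1 a = w2 b := by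
    have h := congrArg (fun w : Equiv.Perm (Fin r) => w (w2 b)) hcd
    simp only [Equiv.Perm.mul_apply, perm_inv_app, Fin.revPerm_apply] at h
    rw [Equiv.Perm.inv_eq_iff_eq, Fin.rev_eq_iff, ← h, w3.injective.eq_iff,
      eq_comm, Equiv.Perm.inv_eq_iff_eq, eq_comm]
  have h2 : (Finset.univ.filter fun i : Fin r =>
            lam i = j ∧ w3⁻¹ i = a ∧ w4⁻¹ (Fin.rev i) = b) =
      if w1 a = w2 b ∧ lam (w3 a) = j then {w3 a} else ∅ := by
    ext i
    rw [Finset.mem_filter]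
    split_ifs with hc
    · rw [Finset.mem_singleton]
      constructor
      · rintro ⟨-, -, h, -⟩; rw [← h]; simp
      · rintro rfl; exact ⟨Finset.mem_univ _, hc.2, by simp, key.2 hc.1⟩
    · simp only [Finset.notMem_empty, iff_false]
      rintro ⟨-, h3, h4, h5⟩
      have : i = w3 a := by rw [← h4]; simp
      subst this
      exact hc ⟨key.1 h5, h3⟩
  rw [h2, theM]
  simp only [Nat.zero_le, true_and]
  split_ifs <;> simp

theorem theM_succ_ne {r : ℕ} (lam : Fin r → ℕ) (w1 w2 w3 : Equiv.Perm (Fin r)) (i : Fin r) (j : ℕ)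
    (ab : Fin r × Fin r) (h : ab ≠ (w1⁻¹ i, w2⁻¹ i)) :
    theM lam w1 w2 w3 (i.val + 1) j ab = theM lam w1 w2 w3 i.val j ab := by
  unfold theM
  congr 1
  apply propext
  constructor
  · rintro ⟨h1, h2, h3⟩; exact ⟨h1, by omega, h3⟩
  · rintro ⟨h1, h2, h3⟩
    refine ⟨h1, ?_, h3⟩
    rcases Nat.lt_or_eq_of_le h2 with h4 | h4
    · exact h4
    · exfalso
      have h5 : i = w1 ab.1 := Fin.ext h4
      apply h
      refine Prod.ext ?_ ?_
      · simp [h5]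
      · simp [h5, h1]

theorem theM_succ_self {r : ℕ} (lam : Fin r → ℕ) (w1 w2 w3 : Equiv.Perm (Fin r)) (i : Fin r)
    (j : ℕ) : theM lam w1 w2 w3 (i.val + 1) j (w1⁻¹ i, w2⁻¹ i) = 0 := by
  simp [theM]

theorem theM_self {r : ℕ} (lam : Fin r → ℕ) (w1 w2 w3 : Equiv.Perm (Fin r)) (i : Fin r)
    (j : ℕ) : theM lam w1 w2 w3 i.val j (w1⁻¹ i, w2⁻¹ i) =
      if lam (w3 (w1⁻¹ i)) = j then 1 else 0 := by
  simp [theM]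

theorem theM_color {r : ℕ} (lam : Fin r → ℕ) (w1 w2 w3 : Equiv.Perm (Fin r)) (i : Fin r)
    (n j : ℕ) (b : Fin r) (h : b ≠ w2⁻¹ i) : theM lam w1 w2 w3 n j (w1⁻¹ i, b) = 0 := by
  unfold theM
  rw [if_neg]
  rintro ⟨h1, -⟩
  apply h
  simp only [perm_app_inv] at h1
  simp [h1]

theorem theM_dolor {r : ℕ} (lam : Fin r → ℕ) (w1 w2 w3 : Equiv.Perm (Fin r)) (i : Fin r)
    (n j : ℕ) (a : Fin r) (h : a ≠ w1⁻¹ i) : theM lam w1 w2 w3 n j (a, w2⁻¹ i) = 0 := by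
  unfold theM
  rw [if_neg]
  rintro ⟨h1, -⟩
  apply h
  simp only [perm_app_inv] at h1
  simp [← h1]

theorem theM_succ_of_ne {r : ℕ} (lam : Fin r → ℕ) (w1 w2 w3 : Equiv.Perm (Fin r)) (i : Fin r)
    (j : ℕ) (h : lam (w3 (w1⁻¹ i)) ≠ j) :
    theM lam w1 w2 w3 (i.val + 1) j = theM lam w1 w2 w3 i.val j := by
  funext ab
  by_cases hab : ab = (w1⁻¹ i, w2⁻¹ i)
  · rw [hab, theM_succ_self, theM_self, if_neg h]
  · exact theM_succ_ne lam w1 w2 w3 i j ab hab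

/-- Uniqueness in one row. -/
theorem row_unique {r N : ℕ} (lam : Fin r → ℕ) (w1 w2 w3 : Equiv.Perm (Fin r)) (i : Fin r)
    (hlam : ∀ q, lam q < N)
    (h : Fin (N + 1) → Spin r) (m' : Fin N → Fin r × Fin r → ℕ)
    (hadm : ∀ j : Fin N,
      AdmissibleVertex (h j.succ) (theM lam w1 w2 w3 i.val j.val) (h j.castSucc) (m' j))
    (h0 : h 0 = Sum.inl (w1⁻¹ i)) (hl : h (Fin.last N) = Sum.inr (w2⁻¹ i)) :
    (∀ j, h j = theH lam w1 w2 w3 i j.val) ∧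
      ∀ j, m' j = theM lam w1 w2 w3 (i.val + 1) j.val := by
  have hcz : ∀ j : ℕ, lam (w3 (w1⁻¹ i)) ≠ j → ∀ b,
      theM lam w1 w2 w3 i.val j (w1⁻¹ i, b) = 0 := by
    intro j hj b
    by_cases hb : b = w2⁻¹ i
    · rw [hb, theM_self, if_neg hj]
    · exact theM_color lam w1 w2 w3 i _ j b hb
  have hdz : ∀ j : ℕ, lam (w3 (w1⁻¹ i)) ≠ j → ∀ a,
      theM lam w1 w2 w3 i.val j (a, w2⁻¹ i) = 0 := by
    intro j hj a
    by_cases ha : a = w1⁻¹ i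
    · rw [ha, theM_self, if_neg hj]
    · exact theM_dolor lam w1 w2 w3 i _ j a ha
  have B : ∀ j : Fin (N + 1), j.val ≤ lam (w3 (w1⁻¹ i)) → h j = Sum.inl (w1⁻¹ i) := by
    intro j
    induction j using Fin.induction with
    | zero => intro _; exact h0
    | succ j ih =>
      intro hj
      simp only [Fin.val_succ] at hj
      have h1 := hadm j
      rw [ih (by simp only [Fin.val_succ, Fin.val_castSucc]; omega)] at h1
      exact (vertex_backward h1 (hcz _ (by omega))).1
  have F : ∀ j : Fin (N + 1), lam (w3 (w1⁻¹ i)) < j.val → h j = Sum.inr (w2⁻¹ i) := by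
    intro j
    induction j using Fin.reverseInduction with
    | last => intro _; exact hl
    | cast j ih =>
      intro hj
      simp only [Fin.val_castSucc] at hj
      have h1 := hadm j
      rw [ih (by simp only [Fin.val_succ, Fin.val_castSucc]; omega)] at h1
      exact (vertex_forward h1 (hdz _ (by omega))).1
  constructor
  · intro j
    unfold theH
    split_ifs with hj
    · exact B j hj
    · exact F j (by omega)
  · intro j
    have h1 := hadm j
    rcases lt_trichotomy (lam (w3 (w1⁻¹ i))) j.val with hj | hj | hj
    · rw [F j.succ (by simp only [Fin.val_succ, Fin.val_castSucc]; omega)] at h1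
      rw [theM_succ_of_ne lam w1 w2 w3 i _ hj.ne]
      exact (vertex_forward h1 (hdz _ hj.ne)).2
    · rw [F j.succ (by simp only [Fin.val_succ, Fin.val_castSucc]; omega), B j.castSucc (by simp only [Fin.val_succ, Fin.val_castSucc]; omega)] at h1
      have h2 := vertex_split h1 (fun b hb => theM_color lam w1 w2 w3 i _ _ b hb)
        (fun a ha => theM_dolor lam w1 w2 w3 i _ _ a ha)
      funext ab
      by_cases hab : ab = (w1⁻¹ i, w2⁻¹ i)
      · rw [hab, theM_succ_self]
        have h3 := h2.1
        rw [theM_self, if_pos hj] at h3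
        omega
      · rw [h2.2 ab hab, theM_succ_ne lam w1 w2 w3 i _ ab hab]
    · rw [B j.castSucc (by simp only [Fin.val_succ, Fin.val_castSucc]; omega)] at h1
      rw [theM_succ_of_ne lam w1 w2 w3 i _ hj.ne.symm]
      exact (vertex_backward h1 (hcz _ hj.ne.symm)).2

/-- if `w_c = w_d`, then the system `S(λ; w_1,w_2,w_3,w_4)` has exactly one
state. -/
theorem stmt5 (r N : ℕ) (hr : 1 ≤ r) (hN : 1 ≤ N)
    (lam : Fin r → ℕ)
    (hpart : ∀ i j : Fin r, i ≤ j → lam j ≤ lam i)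
    (hlam1 : lam ⟨0, hr⟩ ≤ N - 1)
    (w1 w2 w3 w4 : Equiv.Perm (Fin r))
    (hcd : w3 * w1⁻¹ = Fin.revPerm * w4 * w2⁻¹) :
    ∃! f : Filling r N, InSystem lam w1 w2 w3 w4 f := by
  have hlam : ∀ q, lam q < N := by
    intro q
    have := hpart ⟨0, hr⟩ q (Fin.mk_le_of_le_val (Nat.zero_le _))
    omega
  refine ⟨⟨fun i j => theM lam w1 w2 w3 i.val j.val, fun i j => theH lam w1 w2 w3 i j.val⟩,
    ⟨?_, ?_, ?_, ?_, ?_⟩, ?_⟩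
  · intro i j
    simp only [Fin.val_castSucc, Fin.val_succ, theH]
    rcases lt_trichotomy (lam (w3 (w1⁻¹ i))) j.val with hj | hj | hj
    · rw [theM_succ_of_ne lam w1 w2 w3 i _ hj.ne, if_neg (by omega), if_neg (by omega)]
      exact vertex_pass_adm _ _
    · rw [if_neg (by omega), if_pos (by omega)]
      apply vertex_split_adm
      · rw [theM_succ_self, theM_self, if_pos hj]
      · exact fun ab hab => theM_succ_ne lam w1 w2 w3 i _ ab hab
    · rw [theM_succ_of_ne lam w1 w2 w3 i _ hj.ne.symm, if_pos (by omega), if_pos (by omega)]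
      exact vertex_pass_adm _ _
  · intro j a b
    exact theM_top lam w1 w2 w3 w4 hcd j.val a b
  · intro j ab
    have := (w1 ab.1).2
    simp only [theM, Fin.val_last]
    rw [if_neg]
    rintro ⟨-, h, -⟩
    omega
  · intro i
    simp [theH]
  · intro i
    have := hlam (w3 (w1⁻¹ i))
    simp only [theH, Fin.val_last]
    rw [if_neg (by omega)]
  · rintro ⟨m, h⟩ ⟨hs, ht, -, hR, hL⟩
    simp only [Filling.IsState] at hs ht hR hL
    have hm : ∀ (i : Fin (r + 1)) (j : Fin N), m i j = theM lam w1 w2 w3 i.val j.val := by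
      intro i
      induction i using Fin.induction with
      | zero =>
        intro j
        funext ⟨a, b⟩
        rw [ht]
        exact (theM_top lam w1 w2 w3 w4 hcd j.val a b).symm
      | succ i ih =>
        have hrow := row_unique lam w1 w2 w3 i hlam (h i) (m i.succ) (by
          intro j
          have := hs i j
          rwa [ih j] at this) (hR i) (hL i)
        exact hrow.2
    have hh : ∀ (i : Fin r) (j : Fin (N + 1)), h i j = theH lam w1 w2 w3 i j.val := by
      intro i
      have hrow := row_unique lam w1 w2 w3 i hlam (h i) (m i.succ) (by
          intro j
          have := hs i j
          rwa [hm i.castSucc j] at this) (hR i) (hL i)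
      exact hrow.1
    congr 1
    · funext i j; exact hm i j
    · funext i j; exact hh i j
end

section
/- If the system S(λ; w_1,w_2,w_3,w_4) contains a state that has no merge at any vertex, then S(λ; w_1,w_2,w_3,w_4) has exactly one state. -/
theorem bosonOfIdx_surj_s6 {r : ℕ} (ab : Fin r × Fin r) : ∃ k : Fin (r * r), bosonOfIdx k = ab := by
  obtain ⟨a, b⟩ := ab
  have hr : 0 < r := lt_of_le_of_lt (Nat.zero_le _) a.2
  have hlt : (r - 1 - b.val) * r + a.val < r * r := by
    have h1 : r - 1 - b.val + 1 ≤ r := by omega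
    have h2 := Nat.mul_le_mul_right r h1
    have h3 := a.2
    rw [Nat.add_mul] at h2
    omega
  refine ⟨⟨(r - 1 - b.val) * r + a.val, hlt⟩, ?_⟩
  have e1 : ((r - 1 - b.val) * r + a.val) % r = a.val := by
    rw [Nat.mul_add_mod_self_right, Nat.mod_eq_of_lt a.2]
  have e2 : ((r - 1 - b.val) * r + a.val) / r = r - 1 - b.val := by
    rw [Nat.add_comm, Nat.add_mul_div_right _ _ hr, Nat.div_eq_of_lt a.2]
    simp
  have h3 := b.2
  unfold bosonOfIdx
  refine Prod.ext (Fin.ext ?_) (Fin.ext ?_)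
  · exact e1
  · show r - 1 - ((r - 1 - b.val) * r + a.val) / r = b.val
    rw [e2]; omega

theorem vertex_back {r : ℕ} {l rr : Spin r} {m m' : Fin r × Fin r → ℕ} (a : Fin r)
    (h : AdmissibleVertex l m rr m') (hrr : rr ≠ Sum.inl a) (hm : ∀ b, m' (a, b) = 0) :
    l ≠ Sum.inl a ∧ ∀ b, m (a, b) = 0 := by
  obtain ⟨x, h0, h1, hs⟩ := h
  have key : ∀ k : Fin (r * r + 1), x k ≠ Sum.inl a := by
    intro k
    induction k using Fin.reverseInduction with
    | last => rw [h1]; exact hrr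
    | cast k ih =>
      intro hx
      rcases hs k with ⟨h2, _⟩ | ⟨h2, _⟩ | ⟨h2, _, h3⟩
      · exact ih (h2.trans hx)
      · rw [hx] at h2; cases h2
      · rw [hx] at h2
        have h4 := hm (bosonOfIdx k).2
        have h5 : a = (bosonOfIdx k).1 := Sum.inl.inj h2
        rw [h5] at h4
        change m' (bosonOfIdx k) = 0 at h4
        omega
  refine ⟨h0 ▸ key 0, fun b => ?_⟩
  obtain ⟨k, hk⟩ := bosonOfIdx_surj_s6 (a, b)
  have h6 := hs k
  rw [hk] at h6
  rcases h6 with ⟨_, h2⟩ | ⟨_, h2, _⟩ | ⟨h2, _⟩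
  · rw [← h2, hm]
  · exact absurd h2 (key _)
  · exact absurd h2 (key _)

theorem color_gone {r N : ℕ} {lam : Fin r → ℕ} {w1 w2 w3 w4 : Equiv.Perm (Fin r)}
    {f : Filling r N} (hf : InSystem lam w1 w2 w3 w4 f) (a : Fin r) (i : Fin (r + 1)) :
    (w1 a).val < i.val → ∀ j b, f.m i j (a, b) = 0 := by
  obtain ⟨hst, _, hbot, hright, _⟩ := hf
  induction i using Fin.reverseInduction with
  | last => intro _ j b; exact hbot j (a, b)
  | cast i ih =>
    intro hi
    have hi' : (w1 a).val < i.val := hi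
    have ih' := ih (by rw [Fin.val_succ]; omega)
    have hrow : ∀ j : Fin (N + 1), f.h i j ≠ Sum.inl a := by
      intro j
      induction j using Fin.induction with
      | zero =>
        rw [hright]
        intro h
        have h2 : w1⁻¹ i = a := Sum.inl.inj h
        rw [← h2] at hi'
        simp at hi'
      | succ j ihj => exact (vertex_back a (hst i j) ihj (ih' j)).1
    intro j
    exact (vertex_back a (hst i j) (hrow _) (ih' j)).2

theorem vertex_fwd {r : ℕ} {l rr : Spin r} {m m' : Fin r × Fin r → ℕ} (a b : Fin r)
    (h : AdmissibleVertex l m rr m') (hl : l = Sum.inr b ∨ l = Sum.inl a)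
    (hm : ∀ a', 0 < m (a', b) → a' = a) (hm' : ∀ b', m' (a, b') = 0) :
    (rr = Sum.inr b ∨ rr = Sum.inl a) ∧ ∀ ab, ab ≠ (a, b) → m' ab = m ab := by
  obtain ⟨x, h0, h1, hs⟩ := h
  have step : ∀ k : Fin (r * r), (x k.castSucc = Sum.inr b ∨ x k.castSucc = Sum.inl a) →
      (x k.succ = Sum.inr b ∨ x k.succ = Sum.inl a) ∧
      (bosonOfIdx k ≠ (a, b) → m' (bosonOfIdx k) = m (bosonOfIdx k)) := by
    intro k hx
    have hk := hs k
    generalize bosonOfIdx k = p at hk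
    obtain ⟨p, q⟩ := p
    rcases hk with ⟨h2, h3⟩ | ⟨h2, h3, h4⟩ | ⟨h2, h3, h4⟩
    · rw [h2]; exact ⟨hx, fun _ => h3⟩
    · rw [h2] at hx
      rcases hx with hx | hx
      · have hq : q = b := Sum.inr.inj hx
        subst hq
        have hp := hm p (by omega)
        subst hp
        exact ⟨Or.inr h3, fun h => absurd rfl h⟩
      · cases hx
    · rw [h2] at hx
      rcases hx with hx | hx
      · cases hx
      · have hp : p = a := Sum.inl.inj hx
        subst hp
        have := hm' q
        omega
  have key : ∀ k : Fin (r * r + 1), x k = Sum.inr b ∨ x k = Sum.inl a := by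
    intro k
    induction k using Fin.induction with
    | zero => rw [h0]; exact hl
    | succ k ih => exact (step k ih).1
  refine ⟨h1 ▸ key _, fun ab hab => ?_⟩
  obtain ⟨k, rfl⟩ := bosonOfIdx_surj_s6 ab
  exact (step k (key _)).2 hab

theorem vertex_nomerge {r : ℕ} {l rr : Spin r} {m m' : Fin r × Fin r → ℕ} (b : Fin r)
    (E : Fin r → Prop) (h : AdmissibleVertex l m rr m')
    (hl : l = Sum.inr b ∨ ∃ a, l = Sum.inl a ∧ E a)
    (hE : ∀ a, 0 < m (a, b) → E a) (hm : ∀ ab, m' ab ≤ m ab) :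
    rr = Sum.inr b ∨ ∃ a, rr = Sum.inl a ∧ E a := by
  obtain ⟨x, h0, h1, hs⟩ := h
  have key : ∀ k : Fin (r * r + 1), x k = Sum.inr b ∨ ∃ a, x k = Sum.inl a ∧ E a := by
    intro k
    induction k using Fin.induction with
    | zero => rw [h0]; exact hl
    | succ k ih =>
      have hk := hs k
      generalize bosonOfIdx k = p at hk
      obtain ⟨p, q⟩ := p
      rcases hk with ⟨h2, h3⟩ | ⟨h2, h3, h4⟩ | ⟨h2, h3, h4⟩
      · rw [h2]; exact ih
      · rw [h2] at ih
        rcases ih with ih | ⟨_, ih, _⟩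
        · have hq : q = b := Sum.inr.inj ih
          subst hq
          exact Or.inr ⟨p, h3, hE p (by omega)⟩
        · cases ih
      · have := hm (p, q)
        omega
  exact h1 ▸ key _

theorem vertex_det {r : ℕ} {l rr rr' : Spin r} {m m' : Fin r × Fin r → ℕ}
    (h : AdmissibleVertex l m rr m') (h' : AdmissibleVertex l m rr' m') : rr = rr' := by
  obtain ⟨x, h0, h1, hs⟩ := h
  obtain ⟨y, g0, g1, gs⟩ := h'
  have key : ∀ k : Fin (r * r + 1), x k = y k := by
    intro k
    induction k using Fin.induction with
    | zero => rw [h0, g0]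
    | succ k ih =>
      rcases hs k with ⟨h2, h3⟩ | ⟨h2, h3, h4⟩ | ⟨h2, h3, h4⟩ <;>
      rcases gs k with ⟨g2, g3⟩ | ⟨g2, g3, g4⟩ | ⟨g2, g3, g4⟩ <;>
      first
        | omega
        | rw [h2, g2, ih]
        | rw [h3, g3]
  rw [← h1, ← g1, key]

theorem row_next {r N : ℕ} {lam : Fin r → ℕ} {w1 w2 w3 w4 : Equiv.Perm (Fin r)}
    {g : Filling r N} (hg : InSystem lam w1 w2 w3 w4 g) (i : Fin r)
    (hu : ∀ j a', 0 < g.m i.castSucc j (a', w2⁻¹ i) → a' = w1⁻¹ i) (j : Fin N)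
    (ab : Fin r × Fin r) :
    g.m i.succ j ab = if ab = (w1⁻¹ i, w2⁻¹ i) then 0 else g.m i.castSucc j ab := by
  have hz : ∀ j b, g.m i.succ j (w1⁻¹ i, b) = 0 :=
    color_gone hg (w1⁻¹ i) i.succ (by simp)
  obtain ⟨hst, _, _, _, hleft⟩ := hg
  have hrow : ∀ j : Fin (N + 1), g.h i j = Sum.inr (w2⁻¹ i) ∨ g.h i j = Sum.inl (w1⁻¹ i) := by
    intro j
    induction j using Fin.reverseInduction with
    | last => exact Or.inl (hleft i)
    | cast j ih => exact (vertex_fwd _ _ (hst i j) ih (hu j) (hz j)).1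
  split_ifs with h
  · rw [h]; exact hz j _
  · exact (vertex_fwd _ _ (hst i j) (hrow _) (hu j) (hz j)).2 ab h

theorem nomerge_uniq {r N : ℕ} {lam : Fin r → ℕ} {w1 w2 w3 w4 : Equiv.Perm (Fin r)}
    {f : Filling r N} (hf : InSystem lam w1 w2 w3 w4 f)
    (hn : ∀ (i : Fin r) (j : Fin N), ¬HasMergeAt f i j) (i : Fin r) :
    ∀ j a', 0 < f.m i.castSucc j (a', w2⁻¹ i) → a' = w1⁻¹ i := by
  have hmono : ∀ (i : Fin r) j ab, f.m i.succ j ab ≤ f.m i.castSucc j ab := by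
    intro i j ab
    by_contra h
    exact hn i j ⟨ab, not_le.mp h⟩
  have htop : ∀ (i : Fin (r + 1)) j ab, f.m i j ab ≤ f.m 0 j ab := by
    intro i
    induction i using Fin.induction with
    | zero => intro j ab; exact le_rfl
    | succ i ih => intro j ab; exact (hmono i j ab).trans (ih j ab)
  obtain ⟨hst, h0, _, hright, hleft⟩ := hf
  have hrow : ∀ j : Fin (N + 1), f.h i j = Sum.inr (w2⁻¹ i) ∨
      ∃ a, f.h i j = Sum.inl a ∧ ∃ j, 0 < f.m i.castSucc j (a, w2⁻¹ i) := by
    intro j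
    induction j using Fin.reverseInduction with
    | last => exact Or.inl (hleft i)
    | cast j ih =>
      exact vertex_nomerge _ _ (hst i j) ih (fun a ha => ⟨j, ha⟩) (hmono i j)
  have hpos : ∀ j a b, 0 < f.m i.castSucc j (a, b) → w4⁻¹ (Fin.rev (w3 a)) = b := by
    intro j a b h
    have h1 := lt_of_lt_of_le h (htop _ _ _)
    rw [h0, Finset.card_pos] at h1
    obtain ⟨k, hk⟩ := h1
    simp only [Finset.mem_filter, Finset.mem_univ, true_and] at hk
    obtain ⟨_, h2, h3⟩ := hk
    rw [← h2]
    simpa using h3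
  intro j a' ha'
  rcases hrow 0 with h | ⟨a, h, j', hj'⟩
  · rw [hright] at h; cases h
  · rw [hright] at h
    have h1 : w1⁻¹ i = a := Sum.inl.inj h
    subst h1
    have h2 := (hpos _ _ _ ha').trans (hpos _ _ _ hj').symm
    exact w3.injective (Fin.rev_injective (w4⁻¹.injective h2))

/-- if the system contains a state with no merge at any vertex, then the
system has exactly one state. -/
theorem stmt6 (r N : ℕ) (hr : 1 ≤ r) (hN : 1 ≤ N)
    (lam : Fin r → ℕ)
    (hpart : ∀ i j : Fin r, i ≤ j → lam j ≤ lam i)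
    (hlam1 : lam ⟨0, hr⟩ ≤ N - 1)
    (w1 w2 w3 w4 : Equiv.Perm (Fin r))
    (hex : ∃ f : Filling r N, InSystem lam w1 w2 w3 w4 f ∧
      ∀ (i : Fin r) (j : Fin N), ¬HasMergeAt f i j) :
    ∃! f : Filling r N, InSystem lam w1 w2 w3 w4 f := by
  obtain ⟨f, hf, hn⟩ := hex
  refine ⟨f, hf, fun g hg => ?_⟩
  have hm : ∀ i : Fin (r + 1), g.m i = f.m i := by
    intro i
    induction i using Fin.induction with
    | zero =>
      funext j ab
      obtain ⟨a, b⟩ := ab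
      rw [hf.2.1, hg.2.1]
    | succ i ih =>
      have hu := nomerge_uniq hf hn i
      funext j ab
      rw [row_next hf i hu, row_next hg i (by rw [ih]; exact hu), ih]
  have hh : ∀ (i : Fin r) (j : Fin (N + 1)), g.h i j = f.h i j := by
    intro i j
    induction j using Fin.reverseInduction with
    | last => rw [hf.2.2.2.2, hg.2.2.2.2]
    | cast j ih =>
      have h1 := hg.1 i j
      rw [ih, hm, hm] at h1
      exact vertex_det h1 (hf.1 i j)
  obtain ⟨gm, gh⟩ := g
  obtain ⟨fm, fh⟩ := f
  have e1 : gm = fm := funext hm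
  have e2 : gh = fh := funext fun i => funext (hh i)
  rw [e1, e2]
end

section
/- For all w_1, w_2 ∈ S_r and 1 ≤ i ≤ r−1, define L = (1−t)·z_i·Z(w_1,w_2) + (z_i − z_{i+1})·Z(w_1, s_i∘w_2) if ℓ(s_i∘w_2) < ℓ(w_2), and L = (1−t)·z_{i+1}·Z(w_1,w_2) + t·(z_i − z_{i+1})·Z(w_1, s_i∘w_2) if ℓ(s_i∘w_2) > ℓ(w_2); define R = (1−t)·z_i·σ_i(Z(w_1,w_2)) + (z_i − z_{i+1})·σ_i(Z(s_i∘w_1, w_2)) if ℓ(s_i∘w_1) < ℓ(w_1), and R = (1−t)·z_{i+1}·σ_i(Z(w_1,w_2)) + t·(z_i − z_{i+1})·σ_i(Z(s_i∘w_1, w_2)) if ℓ(s_i∘w_1) > ℓ(w_1). Then L = R in ℤ[t][z_1,…,z_r]. -/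
/-- The ring automorphism `σ` of `ℤ[t][z_1,…,z_r]` exchanging `z_a` and `z_b` and fixing
`t` and the other variables. -/
noncomputable def sigmaP {r : ℕ} (a b : Fin r) : PolyR r ≃+* PolyR r :=
  (MvPolynomial.renameEquiv ℤ (Equiv.swap (some a) (some b))).toRingEquiv

namespace YB

open Finset

variable {r : ℕ}

/-- Monochrome vertex as a matrix in the horizontal spins. -/
noncomputable def Tm (z : PolyR r) (ab : Fin r × Fin r) (m m' : ℕ) :
    Matrix (Spin r) (Spin r) (PolyR r) := fun x y =>
  if y = x ∧ m' = m then passWeight z m ab x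
  else if x = Sum.inr ab.2 ∧ y = Sum.inl ab.1 ∧ m = m' + 1 then ∑ j ∈ range m, tP r ^ j
  else if x = Sum.inl ab.1 ∧ y = Sum.inr ab.2 ∧ m' = m + 1 then (1 - tP r) * z
  else 0

/-- exponent of `z` in a pass weight -/
def gam (ab : Fin r × Fin r) : Spin r → ℕ
  | Sum.inl e => if e = ab.1 then 1 else 0
  | Sum.inr e => if e = ab.2 then 0 else if ab.1.val = 0 then 1 else 0

/-- exponent of `t ^ n` in a pass weight -/
def del (ab : Fin r × Fin r) : Spin r → ℕ
  | Sum.inl e => if e < ab.1 then 1 else 0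
  | Sum.inr e => if e < ab.2 then 1 else 0

theorem passWeight_eq (z : PolyR r) (n : ℕ) (ab : Fin r × Fin r) (x : Spin r) :
    passWeight z n ab x = z ^ gam ab x * tP r ^ (del ab x * n) := by
  rcases x with e | e
  · simp only [passWeight, gam, del]
    by_cases h : e = ab.1
    · simp [h]
    · by_cases h' : e < ab.1 <;> simp [h, h']
  · simp only [passWeight, gam, del]
    by_cases h : e = ab.2
    · simp [h]
    · by_cases h' : e < ab.2 <;> by_cases h'' : ab.1.val = 0 <;> simp [h, h', h'', mul_comm]

/-- exponent of `z₁` in the diagonal R-matrix entries (multiplied by `z₁ z₂`) -/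
def expo (a b : ℕ) : Spin r → Spin r → ℕ
  | Sum.inl e, Sum.inl f =>
      if e < f then (if e.val < a ∧ a ≤ f.val then 2 else 1)
      else (if f.val < a ∧ a ≤ e.val then 1 else 2)
  | Sum.inr e, Sum.inr f =>
      if e < f then (if e.val < (if a = 0 then b + 1 else b) ∧
          (if a = 0 then b + 1 else b) ≤ f.val then 2 else 1)
      else (if f.val < (if a = 0 then b + 1 else b) ∧
          (if a = 0 then b + 1 else b) ≤ e.val then 1 else 2)
  | Sum.inl e, Sum.inr f => if f.val ≠ b ∧ 0 < a ∧ a ≤ e.val then 0 else 1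
  | Sum.inr f, Sum.inl e => if f.val ≠ b ∧ 0 < a ∧ a ≤ e.val then 3 else 2

theorem expo_le (a b : ℕ) (x y : Spin r) : expo a b x y ≤ 3 := by
  rcases x with e | e <;> rcases y with f | f <;> simp only [expo] <;> split_ifs <;> omega

theorem expo_anti (a b : ℕ) (x y : Spin r) (h : x ≠ y) :
    expo a b x y + expo a b y x = 3 := by
  rcases x with e | e <;> rcases y with f | f <;> simp only [expo]
  · have h' : e ≠ f := fun h' => h (by rw [h'])
    rcases lt_or_gt_of_ne h' with h1 | h1
    · simp only [h1, not_lt_of_gt h1, if_true, if_false]; split_ifs <;> omega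
    · simp only [h1, not_lt_of_gt h1, if_true, if_false]; split_ifs <;> omega
  · split_ifs <;> omega
  · split_ifs <;> omega
  · have h' : e ≠ f := fun h' => h (by rw [h'])
    rcases lt_or_gt_of_ne h' with h1 | h1
    · simp only [h1, not_lt_of_gt h1, if_true, if_false]; split_ifs <;> omega
    · simp only [h1, not_lt_of_gt h1, if_true, if_false]; split_ifs <;> omega

/-- swap coefficients -/
noncomputable def sg : Spin r → Spin r → PolyR r
  | Sum.inl e, Sum.inl f => if e < f then 1 else tP r
  | Sum.inr e, Sum.inr f => if f < e then 1 else tP r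
  | Sum.inl _, Sum.inr _ => tP r
  | Sum.inr _, Sum.inl _ => 1

/-- a spin which does not interact with the boson `ab` -/
def Inert (ab : Fin r × Fin r) (x : Spin r) : Prop := x ≠ Sum.inl ab.1 ∧ x ≠ Sum.inr ab.2

theorem expo_inert (ab : Fin r × Fin r) (x y : Spin r) (hx : Inert ab x) (hy : Inert ab y)
    (h : x ≠ y) :
    expo ab.1 ab.2 x y + gam ab x = expo (ab.1 + 1) ab.2 x y + gam ab y := by
  obtain ⟨⟨a, ha⟩, ⟨b, hb⟩⟩ := ab
  rcases x with ⟨e, he⟩ | ⟨e, he⟩ <;> rcases y with ⟨f, hf⟩ | ⟨f, hf⟩ <;>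
    simp [Inert] at hx hy h <;> simp only [expo, gam, Fin.mk.injEq, Fin.lt_def] <;>
    split_ifs <;> omega

theorem expo_active (ab : Fin r × Fin r) (x y y' : Spin r) (hx : Inert ab x)
    (hy : ¬ Inert ab y) (hy' : ¬ Inert ab y') :
    expo ab.1 ab.2 x y + gam ab x = expo (ab.1 + 1) ab.2 x y' + gam ab y := by
  obtain ⟨⟨a, ha⟩, ⟨b, hb⟩⟩ := ab
  rcases x with ⟨e, he⟩ | ⟨e, he⟩ <;> rcases y with ⟨f, hf⟩ | ⟨f, hf⟩ <;>
    rcases y' with ⟨f', hf'⟩ | ⟨f', hf'⟩ <;>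
    simp [Inert] at hx hy hy' <;> subst hy <;> subst hy' <;>
    simp only [expo, gam, Fin.mk.injEq, Fin.lt_def] <;>
    split_ifs <;> first | omega | contradiction

theorem sg_right (ab : Fin r × Fin r) (x : Spin r) (hx : Inert ab x) :
    sg x (Sum.inl ab.1) * tP r ^ (del ab x) = sg x (Sum.inr ab.2) := by
  obtain ⟨⟨a, ha⟩, ⟨b, hb⟩⟩ := ab
  rcases x with ⟨e, he⟩ | ⟨e, he⟩ <;>
    simp [Inert] at hx <;> simp only [sg, del, Fin.lt_def] <;>
    split_ifs <;> first | omega | simp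

theorem sg_left (ab : Fin r × Fin r) (x : Spin r) (hx : Inert ab x) :
    sg (Sum.inl ab.1) x = sg (Sum.inr ab.2) x * tP r ^ (del ab x) := by
  obtain ⟨⟨a, ha⟩, ⟨b, hb⟩⟩ := ab
  rcases x with ⟨e, he⟩ | ⟨e, he⟩ <;>
    simp [Inert] at hx <;> simp only [sg, del, Fin.lt_def] <;>
    split_ifs <;> first | omega | simp

/-- diagonal entries of the R-matrix -/
noncomputable def st (z1 z2 : PolyR r) (a b : ℕ) (x y : Spin r) : PolyR r :=
  (1 - tP r) * z1 ^ expo a b x y * z2 ^ (3 - expo a b x y)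

/-- The R-matrix, multiplied by `z₁ z₂`. -/
noncomputable def Rm (z1 z2 : PolyR r) (a b : ℕ) :
    Matrix (Spin r × Spin r) (Spin r × Spin r) (PolyR r) := fun p q =>
  if p.1 = p.2 then (if q = p then z1 * z2 * (z1 - tP r * z2) else 0)
  else if q = p then st z1 z2 a b p.1 p.2
  else if q = p.swap then z1 * z2 * (z1 - z2) * sg p.1 p.2
  else 0

theorem Rm_mul (z1 z2 : PolyR r) (a b : ℕ) {κ : Type*}
    (U : Matrix (Spin r × Spin r) κ (PolyR r)) (x1 x2 : Spin r) (q : κ) :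
    (Rm z1 z2 a b * U) (x1, x2) q =
      if x1 = x2 then z1 * z2 * (z1 - tP r * z2) * U (x1, x2) q
      else st z1 z2 a b x1 x2 * U (x1, x2) q
        + z1 * z2 * (z1 - z2) * sg x1 x2 * U (x2, x1) q := by
  rw [Matrix.mul_apply]
  by_cases h : x1 = x2
  · simp [Rm, h]
  · have h' : ((x2, x1) : Spin r × Spin r) ≠ (x1, x2) := by
      simp [Prod.ext_iff]; intro h1; exact absurd h1.symm h
    rw [if_neg h, Finset.sum_eq_add (x1, x2) (x2, x1) h'.symm]
    · simp [Rm, h, h']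
    · rintro ⟨c1, c2⟩ _ ⟨hc1, hc2⟩
      simp [Rm, h, hc1, hc2]
    · simp
    · simp

theorem mul_Rm (z1 z2 : PolyR r) (a b : ℕ) {κ : Type*}
    (U : Matrix κ (Spin r × Spin r) (PolyR r)) (p : κ) (y1 y2 : Spin r) :
    (U * Rm z1 z2 a b) p (y1, y2) =
      if y1 = y2 then z1 * z2 * (z1 - tP r * z2) * U p (y1, y2)
      else st z1 z2 a b y1 y2 * U p (y1, y2)
        + z1 * z2 * (z1 - z2) * sg y2 y1 * U p (y2, y1) := by
  rw [Matrix.mul_apply]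
  by_cases h : y1 = y2
  · subst h
    rw [if_pos rfl, Finset.sum_eq_single (y1, y1)]
    · simp [Rm, mul_comm]
    · rintro ⟨c1, c2⟩ _ hc
      have : ((y1, y1) : Spin r × Spin r) ≠ (c2, c1) := by
        intro h; apply hc; simp [Prod.ext_iff] at h ⊢; exact ⟨h.2.symm, h.1.symm⟩
      simp [Rm, hc.symm, this]
    · simp
  · have h' : ((y2, y1) : Spin r × Spin r) ≠ (y1, y2) := by
      simp [Prod.ext_iff]; intro h1; exact absurd h1.symm h
    rw [if_neg h, Finset.sum_eq_add (y1, y2) (y2, y1) h'.symm]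
    · simp [Rm, h, Ne.symm h, h'.symm, mul_comm]
    · rintro ⟨c1, c2⟩ _ ⟨hc1, hc2⟩
      have : ((y1, y2) : Spin r × Spin r) ≠ (c2, c1) := by
        intro h; apply hc2; simp [Prod.ext_iff] at h ⊢; exact ⟨h.2.symm, h.1.symm⟩
      simp [Rm, hc1.symm, this]
    · simp
    · simp

/-- Two-row monochrome vertex. -/
noncomputable def Um (z1 z2 : PolyR r) (ab : Fin r × Fin r) (B m m' : ℕ) :
    Matrix (Spin r × Spin r) (Spin r × Spin r) (PolyR r) :=
  ∑ n ∈ range B, Matrix.kroneckerMap (· * ·) (Tm z1 ab m n) (Tm z2 ab n m')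

theorem Um_apply (z1 z2 : PolyR r) (ab : Fin r × Fin r) (B m m' : ℕ) (x1 x2 y1 y2 : Spin r) :
    Um z1 z2 ab B m m' (x1, x2) (y1, y2) =
      ∑ n ∈ range B, Tm z1 ab m n x1 y1 * Tm z2 ab n m' x2 y2 := by
  simp [Um, Matrix.sum_apply, Matrix.kroneckerMap_apply]

theorem Tm_inert (z : PolyR r) (ab : Fin r × Fin r) (m m' : ℕ) (x y : Spin r)
    (hx : Inert ab x) :
    Tm z ab m m' x y = if y = x ∧ m' = m then z ^ gam ab x * tP r ^ (del ab x * m) else 0 := by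
  simp [Tm, hx.1, hx.2, passWeight_eq]

theorem Tm_active_inert (z : PolyR r) (ab : Fin r × Fin r) (m m' : ℕ) (x y : Spin r)
    (hx : ¬ Inert ab x) (hy : Inert ab y) : Tm z ab m m' x y = 0 := by
  have : y ≠ x := by rintro rfl; exact hx hy
  simp [Tm, hy.1, hy.2, this]

theorem Tm_zero (z : PolyR r) (ab : Fin r × Fin r) (m m' : ℕ) (x y : Spin r)
    (h : m + 1 < m') : Tm z ab m m' x y = 0 := by
  have h1 : m' ≠ m := by omega
  have h2 : m ≠ m' + 1 := by omega
  have h3 : m' ≠ m + 1 := by omega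
  simp [Tm, h1, h2, h3]

theorem Um_inert_left (z1 z2 : PolyR r) (ab : Fin r × Fin r) (B m m' : ℕ)
    (x1 x2 y1 y2 : Spin r) (hB : m + 2 ≤ B) (hx : Inert ab x1) :
    Um z1 z2 ab B m m' (x1, x2) (y1, y2) =
      if y1 = x1 then z1 ^ gam ab x1 * tP r ^ (del ab x1 * m) * Tm z2 ab m m' x2 y2 else 0 := by
  rw [Um_apply, Finset.sum_eq_single m]
  · rw [Tm_inert _ _ _ _ _ _ hx]; by_cases h : y1 = x1 <;> simp [h]
  · intro n _ hn; rw [Tm_inert _ _ _ _ _ _ hx]; simp [hn]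
  · intro h; simp at h; omega

theorem Um_inert_right (z1 z2 : PolyR r) (ab : Fin r × Fin r) (B m m' : ℕ)
    (x1 x2 y1 y2 : Spin r) (hB : m + 2 ≤ B) (hx : Inert ab x2) :
    Um z1 z2 ab B m m' (x1, x2) (y1, y2) =
      if y2 = x2 then z2 ^ gam ab x2 * tP r ^ (del ab x2 * m') * Tm z1 ab m m' x1 y1 else 0 := by
  rw [Um_apply, Finset.sum_eq_single m']
  · rw [Tm_inert _ _ _ _ _ _ hx]; by_cases h : y2 = x2 <;> simp [h, mul_comm]
  · intro n _ hn; rw [Tm_inert _ _ _ _ _ _ hx]; simp [Ne.symm hn]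
  · intro h; rw [Tm_zero]; simp; simp at h; omega

theorem Tm_cc (z : PolyR r) (ab : Fin r × Fin r) (m m' : ℕ) :
    Tm z ab m m' (Sum.inl ab.1) (Sum.inl ab.1) = if m' = m then z else 0 := by
  simp [Tm, passWeight]
theorem Tm_dd (z : PolyR r) (ab : Fin r × Fin r) (m m' : ℕ) :
    Tm z ab m m' (Sum.inr ab.2) (Sum.inr ab.2) = if m' = m then 1 else 0 := by
  simp [Tm, passWeight]
theorem Tm_cd (z : PolyR r) (ab : Fin r × Fin r) (m m' : ℕ) :
    Tm z ab m m' (Sum.inl ab.1) (Sum.inr ab.2) = if m' = m + 1 then (1 - tP r) * z else 0 := by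
  simp [Tm]
theorem Tm_dc (z : PolyR r) (ab : Fin r × Fin r) (m m' : ℕ) :
    Tm z ab m m' (Sum.inr ab.2) (Sum.inl ab.1) =
      if m = m' + 1 then ∑ j ∈ range m, tP r ^ j else 0 := by
  simp [Tm]

theorem sum_ite_shift (B m : ℕ) (hB : m + 2 ≤ B) (f : ℕ → PolyR r) :
    ∑ n ∈ range B, (if m = n + 1 then f n else 0) = if m = 0 then 0 else f (m - 1) := by
  rcases m with _ | k
  · simp
  · simp only [Nat.add_right_cancel_iff]
    rw [Finset.sum_ite_eq]
    simp; omega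

theorem Tm_active (z : PolyR r) (ab : Fin r × Fin r) (m m' : ℕ) (x y : Spin r)
    (hx : ¬ Inert ab x) (hy : ¬ Inert ab y) : 
    Tm z ab m m' x y = z ^ gam ab x * Tm 1 ab m m' x y := by
  have hx' : x = Sum.inl ab.1 ∨ x = Sum.inr ab.2 := by
    by_contra h; push Not at h; exact hx h
  have hy' : y = Sum.inl ab.1 ∨ y = Sum.inr ab.2 := by
    by_contra h; push Not at h; exact hy h
  rcases hx' with rfl | rfl <;> rcases hy' with rfl | rfl <;>
    simp only [Tm_cc, Tm_dd, Tm_cd, Tm_dc] <;> split_ifs <;> simp [gam, mul_comm]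

/-- geometric sum: `t ^ n = 1 - (1 - t) [n]` -/
theorem tpow (n : ℕ) : tP r ^ n = 1 - (1 - tP r) * ∑ j ∈ range n, tP r ^ j := by
  have := mul_neg_geom_sum (tP r) n
  rw [this]; ring

theorem not_inert (ab : Fin r × Fin r) (x : Spin r) :
    ¬ Inert ab x ↔ x = Sum.inl ab.1 ∨ x = Sum.inr ab.2 := by
  unfold Inert; tauto

theorem Um_cc (z1 z2 : PolyR r) (ab : Fin r × Fin r) (B m m' : ℕ) (x2 y2 : Spin r)
    (hB : m + 2 ≤ B) : Um z1 z2 ab B m m' (Sum.inl ab.1, x2) (Sum.inl ab.1, y2) =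
      z1 * Tm z2 ab m m' x2 y2 := by
  rw [Um_apply]
  simp only [Tm_cc, ite_mul, zero_mul]
  rw [Finset.sum_ite_eq', if_pos (by simp; omega)]

theorem Um_dd (z1 z2 : PolyR r) (ab : Fin r × Fin r) (B m m' : ℕ) (x2 y2 : Spin r)
    (hB : m + 2 ≤ B) : Um z1 z2 ab B m m' (Sum.inr ab.2, x2) (Sum.inr ab.2, y2) =
      Tm z2 ab m m' x2 y2 := by
  rw [Um_apply]
  simp only [Tm_dd, ite_mul, zero_mul, one_mul]
  rw [Finset.sum_ite_eq', if_pos (by simp; omega)]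

theorem Um_cd (z1 z2 : PolyR r) (ab : Fin r × Fin r) (B m m' : ℕ) (x2 y2 : Spin r)
    (hB : m + 2 ≤ B) : Um z1 z2 ab B m m' (Sum.inl ab.1, x2) (Sum.inr ab.2, y2) =
      (1 - tP r) * z1 * Tm z2 ab (m + 1) m' x2 y2 := by
  rw [Um_apply]
  simp only [Tm_cd, ite_mul, zero_mul]
  rw [Finset.sum_ite_eq', if_pos (by simp; omega)]

theorem Um_dc (z1 z2 : PolyR r) (ab : Fin r × Fin r) (B m m' : ℕ) (x2 y2 : Spin r)
    (hB : m + 2 ≤ B) : Um z1 z2 ab B m m' (Sum.inr ab.2, x2) (Sum.inl ab.1, y2) =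
      if m = 0 then 0 else (∑ j ∈ range m, tP r ^ j) * Tm z2 ab (m - 1) m' x2 y2 := by
  rw [Um_apply]
  simp only [Tm_dc, ite_mul, zero_mul]
  rw [sum_ite_shift _ _ hB]

theorem Um_active_zero (z1 z2 : PolyR r) (ab : Fin r × Fin r) (B m m' : ℕ)
    (x1 x2 y1 y2 : Spin r) (hx1 : ¬ Inert ab x1) (hx2 : ¬ Inert ab x2)
    (hy : Inert ab y1 ∨ Inert ab y2) :
    Um z1 z2 ab B m m' (x1, x2) (y1, y2) = 0 := by
  rw [Um_apply]
  apply Finset.sum_eq_zero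
  intro n _
  rcases hy with hy | hy
  · rw [Tm_active_inert _ _ _ _ _ _ hx1 hy, zero_mul]
  · rw [Tm_active_inert _ _ _ _ _ _ hx2 hy, mul_zero]

theorem st_cd (z1 z2 : PolyR r) (ab : Fin r × Fin r) (a : ℕ) :
    st z1 z2 a ab.2 (Sum.inl ab.1) (Sum.inr ab.2) = (1 - tP r) * z1 * z2 ^ 2 := by
  simp [st, expo]
theorem st_dc (z1 z2 : PolyR r) (ab : Fin r × Fin r) (a : ℕ) :
    st z1 z2 a ab.2 (Sum.inr ab.2) (Sum.inl ab.1) = (1 - tP r) * z1 ^ 2 * z2 := by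
  simp [st, expo]

theorem ybe_active (z1 z2 : PolyR r) (ab : Fin r × Fin r) (B m m' : ℕ)
    (x1 x2 y1 y2 : Spin r) (hB : m + 2 ≤ B) (hx1 : ¬ Inert ab x1) (hx2 : ¬ Inert ab x2)
    (hy1 : ¬ Inert ab y1) (hy2 : ¬ Inert ab y2) :
    (Rm z1 z2 ab.1 ab.2 * Um z1 z2 ab B m m') (x1, x2) (y1, y2) =
      (Um z2 z1 ab B m m' * Rm z1 z2 (ab.1 + 1) ab.2) (x1, x2) (y1, y2) := by
  rw [Rm_mul, mul_Rm]
  rw [not_inert] at hx1 hx2 hy1 hy2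
  rcases hx1 with rfl | rfl <;> rcases hx2 with rfl | rfl <;> rcases hy1 with rfl | rfl <;>
    rcases hy2 with rfl | rfl <;>
    simp only [Um_cc _ _ _ _ _ _ _ _ hB, Um_dd _ _ _ _ _ _ _ _ hB, Um_cd _ _ _ _ _ _ _ _ hB,
      Um_dc _ _ _ _ _ _ _ _ hB, Tm_cc, Tm_dd, Tm_cd, Tm_dc, st_cd, st_dc, sg, if_true,
      reduceCtorEq, if_false] <;>
    (rcases m with _ | _ | m) <;>
    (try simp only [Nat.add_eq_zero_iff, one_ne_zero, and_false, if_false, if_true,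
      Nat.add_sub_cancel, Finset.sum_range_succ, Finset.range_zero, Finset.sum_empty,
      Nat.add_right_cancel_iff]) <;>
    split_ifs <;>
    first
    | ring1
    | (exfalso; omega)
    | (simp only [pow_succ, tpow m]; ring1)

theorem pow_gauge (z1 z2 : PolyR r) (A A' g h : ℕ) (e : A + g = A' + h) (hA : A ≤ 3)
    (hA' : A' ≤ 3) :
    z1 ^ A * z2 ^ (3 - A) * (z1 ^ g * z2 ^ h) = z1 ^ A' * z2 ^ (3 - A') * (z2 ^ g * z1 ^ h) := by
  have e2 : 3 - A + h = 3 - A' + g := by omega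
  calc z1 ^ A * z2 ^ (3 - A) * (z1 ^ g * z2 ^ h) = z1 ^ (A + g) * z2 ^ (3 - A + h) := by ring
    _ = z1 ^ (A' + h) * z2 ^ (3 - A' + g) := by rw [e, e2]
    _ = _ := by ring

theorem st_gauge (z1 z2 : PolyR r) (a b a' b' g h : ℕ) (x y x' y' : Spin r)
    (e : expo a b x y + g = expo a' b' x' y' + h) :
    st z1 z2 a b x y * (z1 ^ g * z2 ^ h) = st z1 z2 a' b' x' y' * (z2 ^ g * z1 ^ h) := by
  have := pow_gauge z1 z2 _ _ g h e (expo_le _ _ _ _) (expo_le _ _ _ _)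
  simp only [st]
  linear_combination (1 - tP r) * this

theorem sg_active_right (ab : Fin r × Fin r) (z : PolyR r) (m m' : ℕ) (i x y : Spin r)
    (hi : Inert ab i) (hx : ¬ Inert ab x) (hy : ¬ Inert ab y) :
    sg i x * tP r ^ (del ab i * m') * Tm z ab m m' x y =
      sg i y * tP r ^ (del ab i * m) * Tm z ab m m' x y := by
  rw [not_inert] at hx hy
  have h := sg_right ab i hi
  rcases hx with rfl | rfl <;> rcases hy with rfl | rfl <;>
    simp only [Tm_cc, Tm_dd, Tm_cd, Tm_dc] <;> split_ifs with hm <;>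
    first
    | simp; done
    | (subst hm; rfl)
    | (subst hm; rw [← h]; ring)

theorem sg_active_left (ab : Fin r × Fin r) (z : PolyR r) (m m' : ℕ) (i x y : Spin r)
    (hi : Inert ab i) (hx : ¬ Inert ab x) (hy : ¬ Inert ab y) :
    sg x i * tP r ^ (del ab i * m) * Tm z ab m m' x y =
      sg y i * tP r ^ (del ab i * m') * Tm z ab m m' x y := by
  rw [not_inert] at hx hy
  have h := sg_left ab i hi
  rcases hx with rfl | rfl <;> rcases hy with rfl | rfl <;>
    simp only [Tm_cc, Tm_dd, Tm_cd, Tm_dc] <;> split_ifs with hm <;>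
    first
    | simp; done
    | (subst hm; rfl)
    | (subst hm; rw [h]; ring)

theorem Um_active_inert (z1 z2 : PolyR r) (ab : Fin r × Fin r) (B m m' : ℕ)
    (x1 x2 y1 y2 : Spin r) (h : (¬ Inert ab x1 ∧ Inert ab y1) ∨ (¬ Inert ab x2 ∧ Inert ab y2)) :
    Um z1 z2 ab B m m' (x1, x2) (y1, y2) = 0 := by
  rw [Um_apply]
  apply Finset.sum_eq_zero
  intro n _
  rcases h with h | h
  · rw [Tm_active_inert _ _ _ _ _ _ h.1 h.2, zero_mul]
  · rw [Tm_active_inert _ _ _ _ _ _ h.1 h.2, mul_zero]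

theorem ybe_inert (z1 z2 : PolyR r) (ab : Fin r × Fin r) (B m m' : ℕ)
    (x1 x2 y1 y2 : Spin r) (hB : m + 2 ≤ B) (hx1 : Inert ab x1) (hx2 : Inert ab x2) :
    (Rm z1 z2 ab.1 ab.2 * Um z1 z2 ab B m m') (x1, x2) (y1, y2) =
      (Um z2 z1 ab B m m' * Rm z1 z2 (ab.1 + 1) ab.2) (x1, x2) (y1, y2) := by
  rw [Rm_mul, mul_Rm]
  simp only [Um_inert_left _ _ _ _ _ _ _ _ _ _ hB hx1, Um_inert_left _ _ _ _ _ _ _ _ _ _ hB hx2,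
    Tm_inert _ _ _ _ _ _ hx1, Tm_inert _ _ _ _ _ _ hx2]
  by_cases hm : m' = m
  swap
  · simp [hm]
  subst hm
  simp only [and_true]
  by_cases h : x1 = x2
  · subst h
    by_cases h1 : y1 = x1 <;> by_cases h2 : y2 = x1
    · subst h1; subst h2; simp only [if_true]; ring
    · subst h1; simp [h2]
    · subst h2; simp [h1]
    · simp [h1, h2]
  · have h' := Ne.symm h
    by_cases h1 : y1 = x1
    · subst h1
      by_cases h2 : y2 = x2
      · subst h2
        simp only [h, h', if_true, if_false]
        have := st_gauge z1 z2 _ _ _ _ _ _ _ _ _ _ (expo_inert ab _ _ hx1 hx2 h)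
        linear_combination (tP r ^ (del ab y1 * m') * tP r ^ (del ab y2 * m')) * this
      · by_cases h3 : y1 = y2 <;> simp [h, h', h2, h3]
    · by_cases h2 : y1 = x2
      · subst h2
        by_cases h3 : y2 = x1
        · subst h3
          simp only [h, h', if_true, if_false]
          ring
        · by_cases h4 : y1 = y2 <;> simp [h, h', h3, h4]
      · by_cases h3 : y1 = y2
        · subst h3; simp [h1, h2, h]
        · simp [h1, h2, h3, h]

theorem ybe_inert_active (z1 z2 : PolyR r) (ab : Fin r × Fin r) (B m m' : ℕ)
    (x1 x2 y1 y2 : Spin r) (hB : m + 2 ≤ B) (hx1 : Inert ab x1) (hx2 : ¬ Inert ab x2) :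
    (Rm z1 z2 ab.1 ab.2 * Um z1 z2 ab B m m') (x1, x2) (y1, y2) =
      (Um z2 z1 ab B m m' * Rm z1 z2 (ab.1 + 1) ab.2) (x1, x2) (y1, y2) := by
  have h : x1 ≠ x2 := by rintro rfl; exact hx2 hx1
  rw [Rm_mul, mul_Rm, if_neg h]
  simp only [Um_inert_left _ _ _ _ _ _ _ _ _ _ hB hx1,
    Um_inert_right _ _ _ _ _ _ _ _ _ _ hB hx1]
  by_cases h1 : y1 = x1
  · subst h1
    by_cases hy2 : Inert ab y2
    · simp [Tm_active_inert _ _ _ _ _ _ hx2 hx1, Tm_active_inert _ _ _ _ _ _ hx2 hy2]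
    · have h2 : y1 ≠ y2 := by rintro rfl; exact hy2 hx1
      have h3 := h2.symm
      simp only [h2, h3, if_true, if_false, mul_zero, add_zero]
      rw [Tm_active z1 _ _ _ _ _ hx2 hy2, Tm_active z2 _ _ _ _ _ hx2 hy2]
      have := st_gauge z1 z2 _ _ _ _ _ _ _ _ _ _ (expo_active ab _ _ _ hx1 hx2 hy2)
      linear_combination (tP r ^ (del ab y1 * m) * Tm 1 ab m m' x2 y2) * this
  · by_cases h2 : y2 = x1
    · subst h2
      by_cases hy1 : Inert ab y1
      · simp [h1, Ne.symm h1, Tm_active_inert _ _ _ _ _ _ hx2 hy1]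
      · simp only [h1, if_true, if_false, mul_zero, zero_add]
        have := sg_active_right ab z1 m m' y2 x2 y1 hx1 hx2 hy1
        linear_combination (z1 * z2 * (z1 - z2) * z2 ^ gam ab y2) * this
    · simp [h1, h2]

theorem ybe_active_inert (z1 z2 : PolyR r) (ab : Fin r × Fin r) (B m m' : ℕ)
    (x1 x2 y1 y2 : Spin r) (hB : m + 2 ≤ B) (hx1 : ¬ Inert ab x1) (hx2 : Inert ab x2) :
    (Rm z1 z2 ab.1 ab.2 * Um z1 z2 ab B m m') (x1, x2) (y1, y2) =
      (Um z2 z1 ab B m m' * Rm z1 z2 (ab.1 + 1) ab.2) (x1, x2) (y1, y2) := by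
  have h : x1 ≠ x2 := by rintro rfl; exact hx1 hx2
  rw [Rm_mul, mul_Rm, if_neg h]
  simp only [Um_inert_left _ _ _ _ _ _ _ _ _ _ hB hx2,
    Um_inert_right _ _ _ _ _ _ _ _ _ _ hB hx2]
  by_cases h1 : y2 = x2
  · subst h1
    by_cases hy1 : Inert ab y1
    · simp [Tm_active_inert _ _ _ _ _ _ hx1 hx2, Tm_active_inert _ _ _ _ _ _ hx1 hy1]
    · have h2 : y1 ≠ y2 := by rintro rfl; exact hy1 hx2
      simp only [h2, if_true, if_false, mul_zero, add_zero]
      rw [Tm_active z1 _ _ _ _ _ hx1 hy1, Tm_active z2 _ _ _ _ _ hx1 hy1]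
      have e : expo ab.1 ab.2 x1 y2 + gam ab x1 =
          expo (ab.1 + 1) ab.2 y1 y2 + gam ab y2 := by
        have e1 := expo_active ab _ _ _ hx2 hx1 hy1
        have e2 := expo_anti (ab.1 : ℕ) ab.2 _ _ h
        have e3 := expo_anti ((ab.1 : ℕ) + 1) ab.2 _ _ h2
        omega
      have := st_gauge z1 z2 _ _ _ _ _ _ _ _ _ _ e
      linear_combination (tP r ^ (del ab y2 * m') * Tm 1 ab m m' x1 y1) * this
  · by_cases h2 : y1 = x2
    · subst h2
      by_cases hy2 : Inert ab y2
      · simp [h1, Ne.symm h1, Tm_active_inert _ _ _ _ _ _ hx1 hy2]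
      · simp only [h1, Ne.symm h1, if_true, if_false, mul_zero, zero_add]
        have := sg_active_left ab z2 m m' y1 x1 y2 hx2 hx1 hy2
        linear_combination (z1 * z2 * (z1 - z2) * z1 ^ gam ab y1) * this
    · simp [h1, h2]

theorem ybe_local (z1 z2 : PolyR r) (ab : Fin r × Fin r) (B m m' : ℕ) (hB : m + 2 ≤ B) :
    Rm z1 z2 ab.1 ab.2 * Um z1 z2 ab B m m' =
      Um z2 z1 ab B m m' * Rm z1 z2 (ab.1 + 1) ab.2 := by
  ext ⟨x1, x2⟩ ⟨y1, y2⟩ : 1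
  by_cases hx1 : Inert ab x1 <;> by_cases hx2 : Inert ab x2
  · exact ybe_inert _ _ _ _ _ _ _ _ _ _ hB hx1 hx2
  · exact ybe_inert_active _ _ _ _ _ _ _ _ _ _ hB hx1 hx2
  · exact ybe_active_inert _ _ _ _ _ _ _ _ _ _ hB hx1 hx2
  · by_cases hy : Inert ab y1 ∨ Inert ab y2
    · rw [Rm_mul, mul_Rm]
      simp only [Um_active_zero _ _ _ _ _ _ _ _ _ _ hx1 hx2 hy,
        Um_active_zero _ _ _ _ _ _ _ _ _ _ hx2 hx1 hy,
        Um_active_zero _ _ _ _ _ _ _ _ _ _ hx1 hx2 hy.symm]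
      simp
    · push Not at hy
      exact ybe_active _ _ _ _ _ _ _ _ _ _ hB hx1 hx2 hy.1 hy.2
theorem train {M : Type*} [Monoid M] (n : ℕ) (R : ℕ → M) (U U' : Fin n → M)
    (h : ∀ k : Fin n, R k * U k = U' k * R (k + 1)) :
    R 0 * (List.ofFn U).prod = (List.ofFn U').prod * R n := by
  induction n generalizing R with
  | zero => simp
  | succ n ih =>
    rw [List.ofFn_succ, List.ofFn_succ, List.prod_cons, List.prod_cons, ← mul_assoc]
    have h0 := h 0
    simp only [Fin.val_zero] at h0
    rw [h0, mul_assoc, mul_assoc]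
    congr 1
    exact ih (fun k => R (k + 1)) _ _ (fun k => by simpa using h k.succ)

theorem kron_prod {X S : Type*} [Fintype X] [DecidableEq X] [CommRing S] (n : ℕ)
    (A B : Fin n → Matrix X X S) :
    Matrix.kroneckerMap (· * ·) (List.ofFn A).prod (List.ofFn B).prod =
      (List.ofFn fun k => Matrix.kroneckerMap (· * ·) (A k) (B k)).prod := by
  induction n with
  | zero => simp
  | succ n ih =>
    rw [List.ofFn_succ, List.ofFn_succ, List.ofFn_succ, List.prod_cons, List.prod_cons,
      List.prod_cons, ← ih]
    exact Matrix.mul_kronecker_mul _ _ _ _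

theorem sum_pi_prod {α S : Type*} [Semiring S] (n : ℕ) (F : Fin n → Finset α)
    (f : Fin n → α → S) :
    ∑ x ∈ Fintype.piFinset F, (List.ofFn fun k => f k (x k)).prod =
      (List.ofFn fun k => ∑ a ∈ F k, f k a).prod := by
  induction n with
  | zero => simp
  | succ n ih =>
    rw [List.ofFn_succ, List.prod_cons, ← ih, Finset.sum_mul_sum, ← Finset.sum_product']
    refine Finset.sum_nbij' (fun x => (x 0, fun k => x k.succ))
      (fun y => Fin.cons y.1 y.2) ?_ ?_ ?_ ?_ ?_
    · intro x hx
      simp only [Fintype.mem_piFinset] at hx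
      simp only [Finset.mem_product, Fintype.mem_piFinset]
      exact ⟨hx 0, fun k => hx k.succ⟩
    · rintro ⟨y0, y⟩ hy
      simp only [Finset.mem_product, Fintype.mem_piFinset] at hy
      simp only [Fintype.mem_piFinset]
      intro k
      refine Fin.cases ?_ (fun k => ?_) k
      · simpa using hy.1
      · simpa using hy.2 k
    · intro x _
      ext k
      refine Fin.cases ?_ (fun k => ?_) k <;> simp
    · rintro ⟨y0, y⟩ _
      simp
    · intro x _
      rw [List.ofFn_succ, List.prod_cons]

theorem sum_pi_prod_equiv {α ι S : Type*} [Semiring S] [Fintype ι] [DecidableEq ι] (n : ℕ)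
    (e : Fin n ≃ ι) (F : ι → Finset α) (f : ι → α → S) :
    ∑ x ∈ Fintype.piFinset F, (List.ofFn fun k => f (e k) (x (e k))).prod =
      (List.ofFn fun k => ∑ a ∈ F (e k), f (e k) a).prod := by
  rw [← sum_pi_prod n (fun k => F (e k)) (fun k => f (e k))]
  refine Finset.sum_nbij' (fun x k => x (e k)) (fun y i => y (e.symm i)) ?_ ?_ ?_ ?_ ?_
  · intro x hx
    simp only [Fintype.mem_piFinset] at hx ⊢
    exact fun k => hx _
  · intro y hy
    simp only [Fintype.mem_piFinset] at hy ⊢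
    intro i
    simpa using hy (e.symm i)
  · intro x _; simp
  · intro x _; simp
  · intro x _; rfl

theorem path_sum {X S : Type*} [Fintype X] [DecidableEq X] [CommRing S] (n : ℕ)
    (A : Fin n → Matrix X X S) (l rr : X) :
    (∑ x : Fin (n + 1) → X, if x 0 = l ∧ x (Fin.last n) = rr then
      ∏ j : Fin n, A j (x j.castSucc) (x j.succ) else 0) = (List.ofFn A).prod l rr := by
  induction n generalizing l with
  | zero =>
    rw [← (Fin.consEquiv (fun _ => X)).sum_comp, Fintype.sum_prod_type]
    rw [Finset.sum_eq_single l]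
    · simp [Fin.consEquiv, Matrix.one_apply]
    · intro b _ hb
      simp [Fin.consEquiv, hb]
    · simp
  | succ n ih =>
    rw [List.ofFn_succ, List.prod_cons, Matrix.mul_apply]
    simp only [← ih]
    rw [← (Fin.consEquiv (fun _ => X)).sum_comp, Fintype.sum_prod_type,
      Finset.sum_eq_single l]
    · simp only [Finset.mul_sum]
      rw [Finset.sum_comm]
      refine Finset.sum_congr rfl fun x _ => ?_
      rw [Finset.sum_eq_single (x 0)]
      · simp [Fin.consEquiv, Fin.prod_univ_succ, ← Fin.succ_last]
      · intro b _ hb; simp [Ne.symm hb]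
      · simp
    · intro b _ hb
      simp [Fin.consEquiv, hb]
    · simp

/-- the bijection between indices and bosons -/
theorem boson_inj : Function.Injective (bosonOfIdx (r := r)) := by
  intro k k' h
  have hr : 0 < r := by
    rcases Nat.eq_zero_or_pos r with h | h
    · exact absurd k.2 (by simp [h])
    · exact h
  simp only [bosonOfIdx, Prod.mk.injEq, Fin.mk.injEq] at h
  have h1 : k.val / r < r := Nat.div_lt_of_lt_mul k.2
  have h2 : k'.val / r < r := Nat.div_lt_of_lt_mul k'.2
  have h3 : k.val / r = k'.val / r := by omega
  ext
  rw [← Nat.div_add_mod k.val r, ← Nat.div_add_mod k'.val r, h3, h.1]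

noncomputable def bosonEquiv : Fin (r * r) ≃ Fin r × Fin r :=
  Equiv.ofBijective bosonOfIdx
    ((Fintype.bijective_iff_injective_and_card _).2 ⟨boson_inj, by simp⟩)

theorem bosonEquiv_apply (k : Fin (r * r)) : bosonEquiv k = bosonOfIdx k := rfl

/-- matrix of a full vertex -/
noncomputable def col (z : PolyR r) (m m' : Fin r × Fin r → ℕ) :
    Matrix (Spin r) (Spin r) (PolyR r) :=
  (List.ofFn fun k => Tm z (bosonEquiv k) (m (bosonEquiv k)) (m' (bosonEquiv k))).prod

/-- matrix of a row -/
noncomputable def row {N : ℕ} (z : PolyR r) (M M' : Fin N → Fin r × Fin r → ℕ) :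
    Matrix (Spin r) (Spin r) (PolyR r) :=
  (List.ofFn fun j => col z (M (Fin.revPerm j)) (M' (Fin.revPerm j))).prod

theorem expo_wrap (b b' : ℕ) (h : b = b' + 1 ∨ (b = 0 ∧ r ≤ b' + 1)) (x y : Spin r) :
    expo r b x y = expo 0 b' x y := by
  rcases x with ⟨e, he⟩ | ⟨e, he⟩ <;> rcases y with ⟨f, hf⟩ | ⟨f, hf⟩ <;>
    simp only [expo, Fin.lt_def] <;>
    split_ifs <;> omega

theorem Rm_wrap (z1 z2 : PolyR r) (b b' : ℕ) (h : b = b' + 1 ∨ (b = 0 ∧ r ≤ b' + 1)) :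
    Rm z1 z2 r b = Rm z1 z2 0 b' := by
  ext p q : 2
  simp only [Rm, st, expo_wrap b b' h]

theorem two_col (z1 z2 : PolyR r) (B : ℕ) (m m'' : Fin r × Fin r → ℕ) :
    ∑ n ∈ Fintype.piFinset (fun _ => range B),
        Matrix.kroneckerMap (· * ·) (col z1 m n) (col z2 n m'') =
      (List.ofFn fun k => Um z1 z2 (bosonEquiv k) B (m (bosonEquiv k)) (m'' (bosonEquiv k))).prod := by
  simp only [col, kron_prod]
  exact sum_pi_prod_equiv (r * r) bosonEquiv (fun _ => range B) (fun s n =>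
    Matrix.kroneckerMap (· * ·) (Tm z1 s (m s) n) (Tm z2 s n (m'' s)))

theorem ybe_col (z1 z2 : PolyR r) (B : ℕ) (m m'' : Fin r × Fin r → ℕ)
    (hB : ∀ s, m s + 2 ≤ B) :
    Rm z1 z2 0 (r - 1) * (∑ n ∈ Fintype.piFinset (fun _ => range B),
        Matrix.kroneckerMap (· * ·) (col z1 m n) (col z2 n m'')) =
      (∑ n ∈ Fintype.piFinset (fun _ => range B),
        Matrix.kroneckerMap (· * ·) (col z2 m n) (col z1 n m'')) * Rm z1 z2 0 (r - 1) := by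
  rw [two_col, two_col]
  have key := train (r * r)
    (fun k => if k = r * r then Rm z1 z2 0 (r - 1) else Rm z1 z2 (k % r) (r - 1 - k / r))
    (fun k => Um z1 z2 (bosonEquiv k) B (m (bosonEquiv k)) (m'' (bosonEquiv k)))
    (fun k => Um z2 z1 (bosonEquiv k) B (m (bosonEquiv k)) (m'' (bosonEquiv k)))
  have h0 : (if 0 = r * r then Rm z1 z2 0 (r - 1) else Rm z1 z2 (0 % r) (r - 1 - 0 / r))
      = Rm z1 z2 0 (r - 1) := by split_ifs <;> simp
  simp only [h0, if_true] at key
  apply key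
  intro k
  have hr : 0 < r := by
    rcases Nat.eq_zero_or_pos r with h | h
    · exact absurd k.2 (by simp [h])
    · exact h
  rw [if_neg k.2.ne]
  have hk : k.val / r < r := Nat.div_lt_of_lt_mul k.2
  have hm : k.val % r < r := Nat.mod_lt _ hr
  have h1 := ybe_local z1 z2 (bosonEquiv k) B (m (bosonEquiv k)) (m'' (bosonEquiv k)) (hB _)
  have e1 : ((bosonEquiv k).1 : ℕ) = k.val % r := rfl
  have e2 : ((bosonEquiv k).2 : ℕ) = r - 1 - k.val / r := rfl
  rw [e1, e2] at h1
  rw [h1]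
  congr 1
  have hdm := Nat.div_add_mod k.val r
  by_cases hlast : k.val % r + 1 = r
  · have hk1 : k.val + 1 = r * (k.val / r + 1) := by rw [Nat.mul_add]; omega
    have d1 : (k.val + 1) / r = k.val / r + 1 := by rw [hk1]; exact Nat.mul_div_cancel_left _ hr
    have d2 : (k.val + 1) % r = 0 := by rw [hk1]; exact Nat.mul_mod_right _ _
    rw [hlast, d1, d2]
    split_ifs with h
    · have : k.val / r + 1 = r := by
        rw [hk1] at h; exact Nat.eq_of_mul_eq_mul_left hr h
      exact Rm_wrap _ _ _ _ (Or.inr (by omega))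
    · have : k.val / r + 1 ≠ r := by
        intro h'; rw [h'] at hk1; exact h hk1
      exact Rm_wrap _ _ _ _ (Or.inl (by omega))
  · have d1 : (k.val + 1) / r = k.val / r := by
      rw [Nat.div_eq_iff hr]
      constructor
      · rw [mul_comm]; omega
      · have : r * (k.val / r) = k.val / r * r := mul_comm _ _
        omega
    have d2 : (k.val + 1) % r = k.val % r + 1 := by
      have := Nat.div_add_mod (k.val + 1) r
      rw [d1] at this; omega
    have hne : k.val + 1 ≠ r * r := by
      intro h; rw [h] at d2; simp at d2
    rw [if_neg hne, d1, d2]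

theorem ybe_row {N : ℕ} (z1 z2 : PolyR r) (B : ℕ) (M M'' : Fin N → Fin r × Fin r → ℕ)
    (hB : ∀ j s, M j s + 2 ≤ B) :
    Rm z1 z2 0 (r - 1) *
      (∑ n ∈ Fintype.piFinset (fun _ : Fin N => Fintype.piFinset fun _ => range B),
        Matrix.kroneckerMap (· * ·) (row z1 M n) (row z2 n M'')) =
      (∑ n ∈ Fintype.piFinset (fun _ : Fin N => Fintype.piFinset fun _ => range B),
        Matrix.kroneckerMap (· * ·) (row z2 M n) (row z1 n M'')) * Rm z1 z2 0 (r - 1) := by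
  simp only [row, kron_prod]
  have e1 := sum_pi_prod_equiv N Fin.revPerm (fun _ : Fin N => Fintype.piFinset fun _ => range B)
    (fun j n => Matrix.kroneckerMap (· * ·) (col z1 (M j) n) (col z2 n (M'' j)))
  have e2 := sum_pi_prod_equiv N Fin.revPerm (fun _ : Fin N => Fintype.piFinset fun _ => range B)
    (fun j n => Matrix.kroneckerMap (· * ·) (col z2 (M j) n) (col z1 n (M'' j)))
  rw [e1, e2]
  exact train N (fun _ => Rm z1 z2 0 (r - 1)) _ _ (fun k => ybe_col _ _ _ _ _ (hB _))
theorem step_cases (z : PolyR r) (m m' : Fin r × Fin r → ℕ) (ab : Fin r × Fin r)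
    (x y : Spin r) (h : StepOK m m' ab x y) :
    Tm z ab (m ab) (m' ab) x y = stepWeight z (m ab) (m' ab) ab x ∧
      y = nextSpin m m' ab x := by
  rcases h with ⟨h1, h2⟩ | ⟨h1, h2, h3⟩ | ⟨h1, h2, h3⟩
  · subst h1; simp [Tm, stepWeight, nextSpin, h2]
  · subst h1; subst h2
    simp [Tm, stepWeight, nextSpin, h3]
  · subst h1; subst h2
    have e : m ab ≠ m ab + 1 + 1 := by omega
    simp [Tm, stepWeight, nextSpin, h3, e]

theorem Tm_not_step (z : PolyR r) (m m' : Fin r × Fin r → ℕ) (ab : Fin r × Fin r)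
    (x y : Spin r) (h : ¬ StepOK m m' ab x y) : Tm z ab (m ab) (m' ab) x y = 0 := by
  unfold StepOK at h
  push Not at h
  obtain ⟨h1, h2, h3⟩ := h
  unfold Tm
  rw [if_neg (fun e => h1 e.1 e.2), if_neg (fun e => h2 e.1 e.2.1 e.2.2),
    if_neg (fun e => h3 e.1 e.2.1 e.2.2)]

theorem path_unique (m m' : Fin r × Fin r → ℕ) (l : Spin r) (x : Fin (r * r + 1) → Spin r)
    (h0 : x 0 = l)
    (h : ∀ k : Fin (r * r), StepOK m m' (bosonOfIdx k) (x k.castSucc) (x k.succ)) :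
    x = fun k => pathSpin m m' l k.val := by
  funext k
  induction k using Fin.induction with
  | zero => simpa [pathSpin] using h0
  | succ k ih =>
    have := (step_cases 0 _ _ _ _ _ (h k)).2
    rw [this, ih]
    simp [pathSpin]

open Classical in
theorem col_apply (z : PolyR r) (m m' : Fin r × Fin r → ℕ) (l rr : Spin r) :
    col z m m' l rr = if AdmissibleVertex l m rr m' then vertexWeight z l m m' else 0 := by
  rw [col, ← path_sum]
  simp only [bosonEquiv_apply]
  have hz : ∀ x : Fin (r * r + 1) → Spin r, x 0 = l →
      (x ≠ (fun k => pathSpin m m' l k.val) ∨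
        ¬ ∀ k : Fin (r * r), StepOK m m' (bosonOfIdx k) (x k.castSucc) (x k.succ)) →
      ∏ j : Fin (r * r), Tm z (bosonOfIdx j) (m (bosonOfIdx j)) (m' (bosonOfIdx j))
        (x j.castSucc) (x j.succ) = 0 := by
    intro x h0 hx
    by_cases h : ∀ k : Fin (r * r), StepOK m m' (bosonOfIdx k) (x k.castSucc) (x k.succ)
    · rcases hx with hx | hx
      · exact absurd (path_unique _ _ _ _ h0 h) hx
      · exact absurd h hx
    · push Not at h
      obtain ⟨k, hk⟩ := h
      exact Finset.prod_eq_zero (Finset.mem_univ k) (Tm_not_step _ _ _ _ _ _ hk)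
  split_ifs with hadm
  · obtain ⟨x, h0, h1, h⟩ := hadm
    rw [Finset.sum_eq_single x]
    · rw [if_pos ⟨h0, h1⟩, vertexWeight]
      refine Finset.prod_congr rfl fun k _ => ?_
      rw [(step_cases z _ _ _ _ _ (h k)).1]
      have := congrFun (path_unique _ _ _ _ h0 h) k.castSucc
      rw [this]; rfl
    · intro y _ hy
      split_ifs with hb
      · refine hz y hb.1 (Or.inl ?_)
        rw [← path_unique _ _ _ _ h0 h]; exact hy
      · rfl
    · simp
  · refine Finset.sum_eq_zero fun x _ => ?_
    split_ifs with hb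
    · refine hz x hb.1 (Or.inr fun h => hadm ⟨x, hb.1, hb.2, h⟩)
    · rfl

theorem row_apply {N : ℕ} (z : PolyR r) (M M' : Fin N → Fin r × Fin r → ℕ) (l rr : Spin r) :
    row z M M' l rr = ∑ h : Fin (N + 1) → Spin r, if h (Fin.last N) = l ∧ h 0 = rr then
      ∏ j : Fin N, col z (M j) (M' j) (h j.succ) (h j.castSucc) else 0 := by
  rw [row, ← path_sum]
  refine Fintype.sum_equiv (Equiv.arrowCongr Fin.revPerm (Equiv.refl _)) _ _ fun x => ?_
  have e : ∀ k, (Equiv.arrowCongr Fin.revPerm (Equiv.refl (Spin r))) x k = x (Fin.rev k) := by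
    intro k; simp [Equiv.arrowCongr]
  simp only [e, Fin.rev_last, Fin.rev_zero]
  refine if_congr Iff.rfl ?_ rfl
  refine Fintype.prod_equiv Fin.revPerm _ _ fun j => ?_
  simp [Fin.rev_succ, Fin.rev_castSucc]

/-- multiplicities on vertical edges -/
abbrev Mult (r N : ℕ) := Fin (r + 1) → Fin N → Fin r × Fin r → ℕ

/-- the allowed range for the multiplicities in each row -/
def Fset (r N : ℕ) (i : Fin (r + 1)) : Finset (Fin N → Fin r × Fin r → ℕ) :=
  Fintype.piFinset fun _ => Fintype.piFinset fun _ => range (r + i.val + 1)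

open Classical in
/-- generalized partition function -/
noncomputable def Zg {N : ℕ} (top : Fin N → Fin r × Fin r → ℕ) (z : Fin r → PolyR r)
    (l rr : Fin r → Spin r) : PolyR r :=
  ∑ m ∈ Fintype.piFinset (Fset r N), if m 0 = top ∧ m (Fin.last r) = 0 then
    ∏ i : Fin r, row (z i) (m i.castSucc) (m i.succ) (l i) (rr i) else 0

/-- top boundary -/
def topM (N : ℕ) (lam : Fin r → ℕ) (w3 w4 : Equiv.Perm (Fin r)) : Fin N → Fin r × Fin r → ℕ :=
  fun j s => (Finset.univ.filter fun i : Fin r =>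
            lam i = j.val ∧ w3⁻¹ i = s.1 ∧ w4⁻¹ (Fin.rev i) = s.2).card

theorem adm_le (l rr : Spin r) (m m' : Fin r × Fin r → ℕ) (h : AdmissibleVertex l m rr m')
    (s : Fin r × Fin r) : m' s ≤ m s + 1 := by
  obtain ⟨x, _, _, h⟩ := h
  have h1 := h (bosonEquiv.symm s)
  rw [← bosonEquiv_apply, Equiv.apply_symm_apply] at h1
  rcases h1 with h1 | h1 | h1 <;> omega

theorem inSystem_bound {N : ℕ} (lam : Fin r → ℕ) (w1 w2 w3 w4 : Equiv.Perm (Fin r))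
    (f : Filling r N) (h : InSystem lam w1 w2 w3 w4 f) :
    f.m ∈ Fintype.piFinset (Fset r N) := by
  simp only [Fintype.mem_piFinset, Fset, Finset.mem_range]
  intro i j s
  induction i using Fin.induction with
  | zero =>
    obtain ⟨a, b⟩ := s
    rw [h.2.1]
    have := Finset.card_filter_le (Finset.univ : Finset (Fin r))
      (fun i : Fin r => lam i = j.val ∧ w3⁻¹ i = a ∧ w4⁻¹ (Fin.rev i) = b)
    simp only [Finset.card_univ, Fintype.card_fin] at this
    simp only [Fin.val_zero]; omega
  | succ i ih =>
    have := adm_le _ _ _ _ (h.1 i j) s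
    simp only [Fin.val_castSucc] at ih
    simp only [Fin.val_succ]; omega

/-- fillings as pairs -/
def fillEquiv (r N : ℕ) : (Mult r N × (Fin r → Fin (N + 1) → Spin r)) ≃ Filling r N where
  toFun p := ⟨p.1, p.2⟩
  invFun f := (f.m, f.h)
  left_inv _ := rfl
  right_inv _ := rfl

theorem partitionZ_eq (N : ℕ) (lam : Fin r → ℕ) (w1 w2 w3 w4 : Equiv.Perm (Fin r)) :
    partitionZ r N lam w1 w2 w3 w4 =
      Zg (topM N lam w3 w4) zP (fun i => Sum.inr (w2⁻¹ i)) (fun i => Sum.inl (w1⁻¹ i)) := by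
  classical
  rw [partitionZ, ← finsum_comp_equiv (fillEquiv r N),
    finsum_eq_sum_of_support_subset (s := Fintype.piFinset (Fset r N) ×ˢ Finset.univ),
    Finset.sum_product]
  · rw [Zg]
    refine Finset.sum_congr rfl fun m _ => ?_
    simp only [row_apply]
    rw [Finset.prod_univ_sum, Fintype.piFinset_univ]
    have hpull : ∀ (p : Prop) [Decidable p] (g : (Fin r → Fin (N + 1) → Spin r) → PolyR r),
        (if p then ∑ H, g H else 0) = ∑ H, if p then g H else 0 := by
      intro p _ g; split_ifs <;> simp
    rw [hpull]
    refine Finset.sum_congr rfl fun H _ => ?_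
    simp only [col_apply]
    by_cases hs : InSystem lam w1 w2 w3 w4 (fillEquiv r N (m, H))
    · have hs' := hs
      obtain ⟨hadm, htop, hbot, hright, hleft⟩ := hs'
      rw [if_pos (by convert hs), if_pos]
      · rw [stateWeight]
        refine Finset.prod_congr rfl fun i _ => ?_
        rw [if_pos ⟨hleft i, hright i⟩]
        refine Finset.prod_congr rfl fun j _ => ?_
        exact (if_pos (hadm i j)).symm
      · constructor
        · funext j s; exact htop j s.1 s.2
        · funext j s; exact hbot j s
    · rw [if_neg (by convert hs)]
      split_ifs with hb
      · symm
        by_contra hne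
        rw [← ne_eq, Finset.prod_ne_zero_iff] at hne
        have h1 : ∀ i, H i (Fin.last N) = Sum.inr (w2⁻¹ i) ∧ H i 0 = Sum.inl (w1⁻¹ i) := by
          intro i
          by_contra h; exact hne i (Finset.mem_univ i) (if_neg h)
        apply hs
        refine ⟨?_, ?_, ?_, fun i => (h1 i).2, fun i => (h1 i).1⟩
        · intro i j
          have h2 := hne i (Finset.mem_univ i)
          rw [if_pos (h1 i), Finset.prod_ne_zero_iff] at h2
          by_contra h3
          exact h2 j (Finset.mem_univ j) (if_neg h3)
        · intro j a b
          exact congrFun (congrFun hb.1 j) (a, b)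
        · intro j s
          exact congrFun (congrFun hb.2 j) s
      · rfl
  · intro p hp
    simp only [Function.mem_support] at hp
    have hs : InSystem lam w1 w2 w3 w4 (fillEquiv r N p) := by
      by_contra h; exact hp (if_neg h)
    simp only [Finset.coe_product, Set.mem_prod, Finset.mem_coe, Finset.coe_univ, Set.mem_univ,
      and_true]
    exact inSystem_bound _ _ _ _ _ _ hs
theorem sum_update {ι α S : Type*} [AddCommMonoid S] [Fintype ι] [DecidableEq ι]
    (F : ι → Finset α) (i : ι) (c : α) (G : (ι → α) → S) :
    ∑ m ∈ Fintype.piFinset F, G m =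
      ∑ m ∈ Fintype.piFinset (Function.update F i {c}), ∑ μ ∈ F i, G (Function.update m i μ) := by
  rw [← Finset.sum_product']
  refine Finset.sum_nbij' (fun m => (Function.update m i c, m i))
    (fun y => Function.update y.1 i y.2) ?_ ?_ ?_ ?_ ?_
  · intro m hm
    simp only [Fintype.mem_piFinset] at hm
    simp only [Finset.mem_product, Fintype.mem_piFinset]
    refine ⟨fun k => ?_, hm i⟩
    by_cases hk : k = i
    · subst hk; simp
    · simpa [hk] using hm k
  · rintro ⟨m, μ⟩ hm
    simp only [Finset.mem_product, Fintype.mem_piFinset] at hm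
    simp only [Fintype.mem_piFinset]
    intro k
    by_cases hk : k = i
    · subst hk; simpa using hm.2
    · simpa [hk] using hm.1 k
  · intro m _
    simp
  · rintro ⟨m, μ⟩ hm
    simp only [Finset.mem_product, Fintype.mem_piFinset] at hm
    have := hm.1 i
    simp only [Function.update_self, Finset.mem_singleton] at this
    simp [← this]
  · intro m _
    simp

/-- two rows with the middle edges summed -/
noncomputable def K2 {N : ℕ} (z1 z2 : PolyR r) (B : ℕ) (M M'' : Fin N → Fin r × Fin r → ℕ) :
    Matrix (Spin r × Spin r) (Spin r × Spin r) (PolyR r) :=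
  ∑ n ∈ Fintype.piFinset (fun _ : Fin N => Fintype.piFinset fun _ => range B),
        Matrix.kroneckerMap (· * ·) (row z1 M n) (row z2 n M'')

open Classical in
/-- the contribution of the other rows -/
noncomputable def Crest {N : ℕ} (top : Fin N → Fin r × Fin r → ℕ) (a b : Fin r)
    (z : Fin r → PolyR r) (l rr : Fin r → Spin r) (m : Mult r N) : PolyR r :=
  if m 0 = top ∧ m (Fin.last r) = 0 then
    ∏ i ∈ (Finset.univ.erase a).erase b, row (z i) (m i.castSucc) (m i.succ) (l i) (rr i) else 0

theorem Crest_congr {N : ℕ} (top : Fin N → Fin r × Fin r → ℕ) (a b : Fin r)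
    (z z' : Fin r → PolyR r) (l rr l' rr' : Fin r → Spin r) (m : Mult r N)
    (h : ∀ i, i ≠ a → i ≠ b → z i = z' i ∧ l i = l' i ∧ rr i = rr' i) :
    Crest top a b z l rr m = Crest top a b z' l' rr' m := by
  unfold Crest
  refine if_congr Iff.rfl ?_ rfl
  refine Finset.prod_congr rfl fun i hi => ?_
  simp only [Finset.mem_erase, Finset.mem_univ, and_true] at hi
  obtain ⟨h1, h2, h3⟩ := h i hi.2 hi.1
  rw [h1, h2, h3]

theorem Zg_split {N : ℕ} (top : Fin N → Fin r × Fin r → ℕ) (a b : Fin r)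
    (hab : b.val = a.val + 1) (z : Fin r → PolyR r) (l rr : Fin r → Spin r) :
    Zg top z l rr = ∑ m ∈ Fintype.piFinset (Function.update (Fset r N) a.succ {0}),
      Crest top a b z l rr m * K2 (z a) (z b) (r + (a.val + 1) + 1) (m a.castSucc) (m b.succ)
        (l a, l b) (rr a, rr b) := by
  have hne : a ≠ b := by intro h; rw [h] at hab; omega
  have hmid : b.castSucc = a.succ := by ext; simp [hab]
  rw [Zg, sum_update (Fset r N) a.succ 0]
  refine Finset.sum_congr rfl fun m _ => ?_
  rw [K2, Matrix.sum_apply, Finset.mul_sum, Fset]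
  refine Finset.sum_congr (by simp) fun μ _ => ?_
  have h0 : (0 : Fin (r + 1)) ≠ a.succ := (Fin.succ_ne_zero a).symm
  have h1 : Fin.last r ≠ a.succ := by rw [← hmid]; exact (Fin.castSucc_lt_last b).ne'
  rw [Crest, Function.update_of_ne h0, Function.update_of_ne h1]
  split_ifs with hb
  · rw [← Finset.mul_prod_erase _ _ (Finset.mem_univ a),
      ← Finset.mul_prod_erase _ _ (Finset.mem_erase.2 ⟨hne.symm, Finset.mem_univ b⟩)]
    have e1 : a.castSucc ≠ a.succ := by simp [Fin.ext_iff]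
    have e2 : b.succ ≠ a.succ := by simp [Fin.ext_iff, hab]
    rw [hmid, Function.update_self, Function.update_of_ne e1, Function.update_of_ne e2]
    have e3 : ∏ x ∈ (univ.erase a).erase b, row (z x) (Function.update m a.succ μ x.castSucc)
        (Function.update m a.succ μ x.succ) (l x) (rr x) =
        ∏ x ∈ (univ.erase a).erase b, row (z x) (m x.castSucc) (m x.succ) (l x) (rr x) := by
      refine Finset.prod_congr rfl fun i hi => ?_
      simp only [Finset.mem_erase, Finset.mem_univ, and_true] at hi
      rw [Function.update_of_ne, Function.update_of_ne]
      · intro h; exact hi.2 (Fin.succ_injective _ h)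
      · rw [← hmid]; intro h; exact hi.1 (Fin.castSucc_injective _ h)
    rw [e3]
    simp only [Matrix.kroneckerMap_apply]
    ring
  · simp

theorem exchange {N : ℕ} (top : Fin N → Fin r × Fin r → ℕ) (a b : Fin r)
    (hab : b.val = a.val + 1) (z : Fin r → PolyR r) (l rr : Fin r → Spin r)
    (hl : l a ≠ l b) (hr : rr a ≠ rr b) :
    st (z a) (z b) 0 (r - 1) (l a) (l b) * Zg top z l rr +
      z a * z b * (z a - z b) * sg (l a) (l b) *
        Zg top z (fun i => l (Equiv.swap a b i)) rr =
    st (z a) (z b) 0 (r - 1) (rr a) (rr b) * Zg top (fun i => z (Equiv.swap a b i)) l rr +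
      z a * z b * (z a - z b) * sg (rr b) (rr a) *
        Zg top (fun i => z (Equiv.swap a b i)) l (fun i => rr (Equiv.swap a b i)) := by
  simp only [Zg_split top a b hab, Finset.mul_sum, ← Finset.sum_add_distrib]
  refine Finset.sum_congr rfl fun m hm => ?_
  have hs : ∀ i, i ≠ a → i ≠ b → Equiv.swap a b i = i := fun i h1 h2 =>
    Equiv.swap_apply_of_ne_of_ne h1 h2
  rw [Crest_congr top a b z z (fun i => l (Equiv.swap a b i)) rr l rr m
      (fun i h1 h2 => by simp [hs i h1 h2]),
    Crest_congr top a b (fun i => z (Equiv.swap a b i)) z l rr l rr m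
      (fun i h1 h2 => by simp [hs i h1 h2]),
    Crest_congr top a b (fun i => z (Equiv.swap a b i)) z l (fun i => rr (Equiv.swap a b i)) l rr m
      (fun i h1 h2 => by simp [hs i h1 h2])]
  simp only [Equiv.swap_apply_left, Equiv.swap_apply_right]
  have hB : ∀ j s, m a.castSucc j s + 2 ≤ r + (a.val + 1) + 1 := by
    intro j s
    rw [Fintype.mem_piFinset] at hm
    have h1 := hm a.castSucc
    have e1 : a.castSucc ≠ a.succ := by simp [Fin.ext_iff]
    rw [Function.update_of_ne e1, Fset, Fintype.mem_piFinset] at h1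
    have h2 := h1 j
    rw [Fintype.mem_piFinset] at h2
    have h3 := h2 s
    simp at h3
    omega
  have key := congrFun (congrFun (ybe_row (z a) (z b) _ (m a.castSucc) (m b.succ) hB)
    (l a, l b)) (rr a, rr b)
  change (Rm (z a) (z b) 0 (r - 1) * K2 (z a) (z b) _ (m a.castSucc) (m b.succ)) _ _ =
    (K2 (z b) (z a) _ (m a.castSucc) (m b.succ) * Rm (z a) (z b) 0 (r - 1)) _ _ at key
  rw [Rm_mul, mul_Rm, if_neg hl, if_neg hr] at key
  linear_combination (Crest top a b z l rr m) * key

theorem sigma_t (a b : Fin r) : sigmaP a b (tP r) = tP r := by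
  simp [sigmaP, tP, Equiv.swap_apply_of_ne_of_ne]

theorem sigma_z (a b i : Fin r) : sigmaP a b (zP i) = zP (Equiv.swap a b i) := by
  have : Equiv.swap (some a) (some b) (some i) = some (Equiv.swap a b i) := by
    simp only [Equiv.swap_apply_def, Option.some.injEq]
    split_ifs <;> rfl
  simp [sigmaP, zP, this]

theorem sigma_Tm (a b : Fin r) (z : PolyR r) (ab : Fin r × Fin r) (m m' : ℕ) :
    (sigmaP a b : PolyR r →+* PolyR r).mapMatrix (Tm z ab m m') =
      Tm (sigmaP a b z) ab m m' := by
  ext1 x y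
  simp only [RingHom.mapMatrix_apply, Matrix.map_apply, RingHom.coe_coe, Tm, passWeight_eq]
  split_ifs <;> simp [sigma_t]

theorem sigma_col (a b : Fin r) (z : PolyR r) (m m' : Fin r × Fin r → ℕ) :
    (sigmaP a b : PolyR r →+* PolyR r).mapMatrix (col z m m') = col (sigmaP a b z) m m' := by
  rw [col, map_list_prod, List.map_ofFn, col]
  congr 2
  funext k
  exact sigma_Tm _ _ _ _ _ _

theorem sigma_row {N : ℕ} (a b : Fin r) (z : PolyR r) (M M' : Fin N → Fin r × Fin r → ℕ) :
    (sigmaP a b : PolyR r →+* PolyR r).mapMatrix (row z M M') = row (sigmaP a b z) M M' := by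
  rw [row, map_list_prod, List.map_ofFn, row]
  congr 2
  funext k
  exact sigma_col _ _ _ _ _

theorem sigma_Zg {N : ℕ} (top : Fin N → Fin r × Fin r → ℕ) (a b : Fin r)
    (z : Fin r → PolyR r) (l rr : Fin r → Spin r) :
    sigmaP a b (Zg top z l rr) = Zg top (fun i => sigmaP a b (z i)) l rr := by
  rw [Zg, map_sum, Zg]
  refine Finset.sum_congr rfl fun m _ => ?_
  split_ifs
  · rw [map_prod]
    refine Finset.prod_congr rfl fun i _ => ?_
    rw [← sigma_row]; rfl
  · simp

theorem inv_lt (a b : Fin r) (hab : b.val = a.val + 1) (w : Equiv.Perm (Fin r))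
    (h : w⁻¹ a < w⁻¹ b) : invCount w < invCount (Equiv.swap a b * w) := by
  have e1 : ∀ x, w (w⁻¹ x) = x := fun x => w.apply_symm_apply x
  have e2 : ∀ x, w⁻¹ (w x) = x := fun x => w.symm_apply_apply x
  unfold invCount
  apply Finset.card_lt_card
  rw [Finset.ssubset_iff_of_subset]
  · refine ⟨(w⁻¹ a, w⁻¹ b), ?_, ?_⟩
    · refine Finset.mem_filter.2 ⟨Finset.mem_univ _, h, ?_⟩
      simp only [Equiv.Perm.mul_apply, e1, Equiv.swap_apply_left,
        Equiv.swap_apply_right]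
      rw [Fin.lt_def]; omega
    · intro hm
      have h' := (Finset.mem_filter.1 hm).2.2
      simp only [e1] at h'
      rw [Fin.lt_def] at h'; omega
  · intro x hx
    obtain ⟨p, q⟩ := x
    have hp := (Finset.mem_filter.1 hx).2
    refine Finset.mem_filter.2 ⟨Finset.mem_univ _, hp.1, ?_⟩
    have h1 : ¬ (w q = a ∧ w p = b) := by
      rintro ⟨h1, h2⟩
      rw [← h1, ← h2, e2, e2] at h
      exact absurd hp.1 (not_lt_of_gt h)
    have h2 : w q < w p := hp.2
    show Equiv.swap a b (w q) < Equiv.swap a b (w p)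
    clear hp hx h
    generalize w p = x at h1 h2 ⊢
    generalize w q = y at h1 h2 ⊢
    simp only [Equiv.swap_apply_def, Fin.ext_iff, Fin.lt_def] at h1 h2 ⊢
    split_ifs <;> omega

theorem inv_iff (a b : Fin r) (hab : b.val = a.val + 1) (w : Equiv.Perm (Fin r)) :
    invCount (Equiv.swap a b * w) < invCount w ↔ w⁻¹ b < w⁻¹ a := by
  constructor
  · intro h
    by_contra h'
    have hne : w⁻¹ a ≠ w⁻¹ b := by
      intro e; have := w⁻¹.injective e; rw [this] at hab; omega
    have := inv_lt a b hab w (lt_of_le_of_ne (not_lt.1 h') hne)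
    omega
  · intro h
    have := inv_lt a b hab (Equiv.swap a b * w) (by simpa [mul_inv_rev] using h)
    rwa [← mul_assoc, Equiv.swap_mul_self, one_mul] at this

theorem st_dolor (z1 z2 : PolyR r) (e f : Fin r) (h : e ≠ f) :
    st z1 z2 0 (r - 1) (Sum.inr e) (Sum.inr f) =
      z1 * z2 * (if f < e then (1 - tP r) * z1 else (1 - tP r) * z2) := by
  have he := e.2
  have hf := f.2
  have h1 : expo 0 (r - 1) (Sum.inr e) (Sum.inr f) = if f < e then 2 else 1 := by
    have h' : e.val ≠ f.val := fun h' => h (Fin.ext h')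
    simp only [expo, Fin.lt_def]
    split_ifs <;> omega
  rw [st, h1]
  split_ifs <;> ring

theorem st_color (z1 z2 : PolyR r) (e f : Fin r) (h : e ≠ f) :
    st z1 z2 0 (r - 1) (Sum.inl e) (Sum.inl f) =
      z1 * z2 * (if f < e then (1 - tP r) * z1 else (1 - tP r) * z2) := by
  have h1 : expo 0 (r - 1) (Sum.inl e) (Sum.inl f) = if f < e then 2 else 1 := by
    have h' : e.val ≠ f.val := fun h' => h (Fin.ext h')
    simp only [expo, Fin.lt_def]
    split_ifs <;> omega
  rw [st, h1]
  split_ifs <;> ring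

theorem main (N : ℕ) (lam : Fin r → ℕ) (w3 w4 w1 w2 : Equiv.Perm (Fin r)) (a b : Fin r)
    (hab : b.val = a.val + 1) :
    (if invCount (Equiv.swap a b * w2) < invCount w2 then
        (1 - tP r) * zP a * partitionZ r N lam w1 w2 w3 w4 +
          (zP a - zP b) * partitionZ r N lam w1 (Equiv.swap a b * w2) w3 w4
      else
        (1 - tP r) * zP b * partitionZ r N lam w1 w2 w3 w4 +
          tP r * (zP a - zP b) * partitionZ r N lam w1 (Equiv.swap a b * w2) w3 w4) =
    (if invCount (Equiv.swap a b * w1) < invCount w1 then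
        (1 - tP r) * zP a * sigmaP a b (partitionZ r N lam w1 w2 w3 w4) +
          (zP a - zP b) * sigmaP a b (partitionZ r N lam (Equiv.swap a b * w1) w2 w3 w4)
      else
        (1 - tP r) * zP b * sigmaP a b (partitionZ r N lam w1 w2 w3 w4) +
          tP r * (zP a - zP b) *
            sigmaP a b (partitionZ r N lam (Equiv.swap a b * w1) w2 w3 w4)) := by
  have hne : a ≠ b := by intro h; rw [h] at hab; omega
  have h1 : w1⁻¹ a ≠ w1⁻¹ b := fun e => hne (w1⁻¹.injective e)
  have h2 : w2⁻¹ a ≠ w2⁻¹ b := fun e => hne (w2⁻¹.injective e)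
  have key := exchange (topM N lam w3 w4) a b hab zP (fun i => Sum.inr (w2⁻¹ i))
    (fun i => Sum.inl (w1⁻¹ i)) (by simpa using h2) (by simpa using h1)
  have hz : (zP a * zP b : PolyR r) ≠ 0 :=
    mul_ne_zero (MvPolynomial.X_ne_zero _) (MvPolynomial.X_ne_zero _)
  simp only [inv_iff a b hab, partitionZ_eq, sigma_Zg, sigma_z, mul_inv_rev, Equiv.swap_inv,
    Equiv.Perm.mul_apply]
  simp only [st_dolor _ _ _ _ h2, st_color _ _ _ _ h1, sg] at key
  apply mul_left_cancel₀ hz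
  split_ifs at key ⊢ <;> linear_combination key

end YB

/-- the four-term recurrence relation for the partition function. -/
theorem stmt9 (r N : ℕ) (hr : 1 ≤ r) (hN : 1 ≤ N)
    (lam : Fin r → ℕ)
    (hpart : ∀ i j : Fin r, i ≤ j → lam j ≤ lam i)
    (hlam1 : lam ⟨0, hr⟩ ≤ N - 1)
    (w3 w4 : Equiv.Perm (Fin r))
    (w1 w2 : Equiv.Perm (Fin r))
    (i : ℕ) (h1 : 1 ≤ i) (h2 : i ≤ r - 1) :
    let a : Fin r := ⟨i - 1, by omega⟩
    let b : Fin r := ⟨i, by omega⟩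
    let s : Equiv.Perm (Fin r) := Equiv.swap a b
    let Z : Equiv.Perm (Fin r) → Equiv.Perm (Fin r) → PolyR r := fun u v =>
      partitionZ r N lam u v w3 w4
    (if invCount (s * w2) < invCount w2 then
        (1 - tP r) * zP a * Z w1 w2 + (zP a - zP b) * Z w1 (s * w2)
      else
        (1 - tP r) * zP b * Z w1 w2 + tP r * (zP a - zP b) * Z w1 (s * w2)) =
    (if invCount (s * w1) < invCount w1 then
        (1 - tP r) * zP a * sigmaP a b (Z w1 w2) +
          (zP a - zP b) * sigmaP a b (Z (s * w1) w2)
      else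
        (1 - tP r) * zP b * sigmaP a b (Z w1 w2) +
          tP r * (zP a - zP b) * sigmaP a b (Z (s * w1) w2)) := by
  intro a b s Z
  exact YB.main N lam w3 w4 w1 w2 a b (by show i = i - 1 + 1; omega)
end
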